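/- arXiv:2505.02404 — 3 statements merged into one kernel-verified Lean document; each statement's English description precedes it below -/
import Mathlib

section
/- Let k₁ = 2 and 2 ≤ t ≤ min(k₂, d). Then √𝓘_C = ⋂_{S ⊆ [2]×[k₂]} I_S; that is, the radical of the conditional independence ideal equals the intersection of the ideals I_S themselves, without taking radicals of the components. -/
noncomputable section

open MvPolynomial

namespace CI

/-- The column index set `[k₁] × [k₂]`. -/
abbrev Col (k₁ k₂ : ℕ) := Fin k₁ × Fin k₂

/-- The polynomial ring `ℂ[X]` in the entries of the `d × (k₁k₂)` matrix `X` of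
indeterminates `x_{i,(j,ℓ)}`. -/
abbrev MvP (d k₁ k₂ : ℕ) := MvPolynomial (Fin d × Col k₁ k₂) ℂ

/-- The `r × r` minor of `X` with rows `a` and columns `b`. -/
def minorPoly (d k₁ k₂ r : ℕ) (a : Fin r → Fin d) (b : Fin r → Col k₁ k₂) :
    MvP d k₁ k₂ :=
  (Matrix.of fun i j => (X (a i, b j) : MvP d k₁ k₂)).det

/-- `F_r(X_U)`: the set of all `r × r` minors of the submatrix `X_U`. -/
def minorSet (d k₁ k₂ r : ℕ) (U : Set (Col k₁ k₂)) : Set (MvP d k₁ k₂) :=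
  { f | ∃ a : Fin r → Fin d, ∃ b : Fin r → Col k₁ k₂,
      Function.Injective a ∧ Function.Injective b ∧ (∀ i, b i ∈ U) ∧
      f = minorPoly d k₁ k₂ r a b }

/-- `I_r(X_U)`: the ideal generated by the `r × r` minors of `X_U`. -/
def minorIdeal (d k₁ k₂ r : ℕ) (U : Set (Col k₁ k₂)) : Ideal (MvP d k₁ k₂) :=
  Ideal.span (minorSet d k₁ k₂ r U)

/-- The row slice `R_i = {i} × [k₂]`. -/
def rowSlice (k₁ k₂ : ℕ) (i : Fin k₁) : Set (Col k₁ k₂) := { p | p.1 = i }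

/-- The column slice `C_j = [k₁] × {j}`. -/
def colSlice (k₁ k₂ : ℕ) (j : Fin k₂) : Set (Col k₁ k₂) := { p | p.2 = j }

/-- The conditional independence ideal `𝓘_C = Σ_j I_2(X_{C_j}) + Σ_i I_t(X_{R_i})`. -/
def ciIdeal (d k₁ k₂ t : ℕ) : Ideal (MvP d k₁ k₂) :=
  (⨆ j : Fin k₂, minorIdeal d k₁ k₂ 2 (colSlice k₁ k₂ j)) ⊔
    ⨆ i : Fin k₁, minorIdeal d k₁ k₂ t (rowSlice k₁ k₂ i)

/-- `I_∅ = I_t(X) + Σ_j I_2(X_{C_j})`. -/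
def Iempty (d k₁ k₂ t : ℕ) : Ideal (MvP d k₁ k₂) :=
  minorIdeal d k₁ k₂ t Set.univ ⊔
    ⨆ j : Fin k₂, minorIdeal d k₁ k₂ 2 (colSlice k₁ k₂ j)

/-! ### The case `k₁ = 2`: the ideals `I_S` -/

/-- The column slice `C_j` does not meet `S`. -/
def colOK (k₂ : ℕ) (S : Set (Col 2 k₂)) (j : Fin k₂) : Prop := ∀ i : Fin 2, (i, j) ∉ S

/-- `𝒞(S)`: the union of all column slices not meeting `S`. -/
def CSet (k₂ : ℕ) (S : Set (Col 2 k₂)) : Set (Col 2 k₂) := { p | colOK k₂ S p.2 }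

/-- The condition `Z(1,S) ∖ Z(2,S) ≠ ∅` and `Z(2,S) ∖ Z(1,S) ≠ ∅` under which the
`(t-1)`-minors are included in `F_S`. -/
def tCond (k₂ : ℕ) (S : Set (Col 2 k₂)) : Prop :=
  (∃ ℓ, ((0 : Fin 2), ℓ) ∈ S ∧ ((1 : Fin 2), ℓ) ∉ S) ∧
  (∃ ℓ, ((1 : Fin 2), ℓ) ∈ S ∧ ((0 : Fin 2), ℓ) ∉ S)

/-- The generating set `F_S` of the ideal `I_S` (for `k₁ = 2`). -/
def FSset (d k₂ t : ℕ) (S : Set (Col 2 k₂)) : Set (MvP d 2 k₂) :=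
  minorSet d 2 k₂ 1 S ∪
  (⋃ j ∈ { j : Fin k₂ | colOK k₂ S j }, minorSet d 2 k₂ 2 (colSlice 2 k₂ j)) ∪
  (⋃ _ : tCond k₂ S, minorSet d 2 k₂ (t - 1) (CSet k₂ S)) ∪
  minorSet d 2 k₂ t ((rowSlice 2 k₂ 0 \ S) ∪ CSet k₂ S) ∪
  minorSet d 2 k₂ t ((rowSlice 2 k₂ 1 \ S) ∪ CSet k₂ S)

/-- The ideal `I_S ⊆ ℂ[X]` for `S ⊆ [2] × [k₂]`, generated by `F_S`. -/
def ISIdeal (d k₂ t : ℕ) (S : Set (Col 2 k₂)) : Ideal (MvP d 2 k₂) :=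
  Ideal.span (FSset d k₂ t S)

/-- `u = min(|R₁ ∩ S|, |R₂ ∩ S|)`, the first entry of the combinatorial type of `S`. -/
def uOf (k₂ : ℕ) (S : Set (Col 2 k₂)) : ℕ :=
  min ((rowSlice 2 k₂ 0 ∩ S).ncard) ((rowSlice 2 k₂ 1 ∩ S).ncard)

/-- `v = max(|R₁ ∩ S|, |R₂ ∩ S|)`, the second entry of the combinatorial type of `S`. -/
def vOf (k₂ : ℕ) (S : Set (Col 2 k₂)) : ℕ :=
  max ((rowSlice 2 k₂ 0 ∩ S).ncard) ((rowSlice 2 k₂ 1 ∩ S).ncard)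

/-- `S` contains no column slice. -/
def noColumn (k₂ : ℕ) (S : Set (Col 2 k₂)) : Prop :=
  ∀ j : Fin k₂, ¬ colSlice 2 k₂ j ⊆ S

/-- A subset `S ⊆ [2] × [k₂]` is minimal: `S = ∅`, or `S` contains no column slice,
its combinatorial type `(u,v)` satisfies `1 ≤ u ≤ v ≤ k₂ - t + 1`, and `u + v = k₂`
in case `t = 2`. -/
def minimalSubset (k₂ t : ℕ) (S : Set (Col 2 k₂)) : Prop :=
  S = ∅ ∨ (noColumn k₂ S ∧ 1 ≤ uOf k₂ S ∧ uOf k₂ S ≤ vOf k₂ S ∧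
    vOf k₂ S ≤ k₂ - t + 1 ∧ (t = 2 → uOf k₂ S + vOf k₂ S = k₂))

/-! ### Hypergraphs and their closure -/

/-- The hypergraph `H(S)` on `[k₁] × [k₂]`: its hyperedges are (1) the singletons of
elements of `S`; (2) the 2-subsets of a column slice disjoint from `S`; (3) the
`(t-1)`-subsets of `{i,j} × (NZ(i,S) ∩ NZ(j,S))` for distinct rows `i, j` with
`Z(i,S) ∖ Z(j,S) ≠ ∅` and `Z(j,S) ∖ Z(i,S) ≠ ∅`; (4) the `t`-subsets of a row slice
disjoint from `S`. -/
def HS (k₁ k₂ t : ℕ) (S : Set (Col k₁ k₂)) : Set (Finset (Col k₁ k₂)) :=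
  { e | (∃ p ∈ S, e = {p})
      ∨ (e.card = 2 ∧ (∃ j, ∀ p ∈ e, p.2 = j) ∧ ∀ p ∈ e, p ∉ S)
      ∨ (e.card = t - 1 ∧ ∃ i j : Fin k₁, i ≠ j ∧
           (∃ ℓ, (i, ℓ) ∈ S ∧ (j, ℓ) ∉ S) ∧ (∃ ℓ, (j, ℓ) ∈ S ∧ (i, ℓ) ∉ S) ∧
           ∀ p ∈ e, (p.1 = i ∨ p.1 = j) ∧ (i, p.2) ∉ S ∧ (j, p.2) ∉ S)
      ∨ (e.card = t ∧ (∃ i, ∀ p ∈ e, p.1 = i) ∧ ∀ p ∈ e, p ∉ S) }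

/-- The closure of a hypergraph: iterate the rule "if `{a,b}` and `e` (with `a ∈ e`)
are hyperedges, then add `(e ∖ {a}) ∪ {b}`". -/
inductive HClosure {k₁ k₂ : ℕ} (H : Set (Finset (Col k₁ k₂))) :
    Finset (Col k₁ k₂) → Prop
  | base {e : Finset (Col k₁ k₂)} : e ∈ H → HClosure H e
  | step {e : Finset (Col k₁ k₂)} (a b : Col k₁ k₂) :
      a ∈ e → HClosure H {a, b} → HClosure H e → HClosure H (insert b (e.erase a))

/-- The determinantal ideal of a hypergraph: it is generated by the minors `[A|B]`
with `A ⊆ [d]`, `B` a hyperedge, and `|A| = |B|`. -/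
def hypIdeal (d k₁ k₂ : ℕ) (H : Set (Finset (Col k₁ k₂))) : Ideal (MvP d k₁ k₂) :=
  Ideal.span { f | ∃ e ∈ H, ∃ a : Fin e.card → Fin d, ∃ b : Fin e.card → Col k₁ k₂,
      Function.Injective a ∧ Function.Injective b ∧ (∀ i, b i ∈ e) ∧
      f = minorPoly d k₁ k₂ e.card a b }

/-- The ideal `I_S` associated to the closure of the hypergraph `H(S)`. -/
def ISclosure (d k₁ k₂ t : ℕ) (S : Set (Col k₁ k₂)) : Ideal (MvP d k₁ k₂) :=
  hypIdeal d k₁ k₂ { e | HClosure (HS k₁ k₂ t S) e }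

/-! ### The lexicographic monomial order -/

/-- `varLT a b` means the variable `x_a` is *larger* than `x_b` in the variable order
`x_{1,(1,1)} > x_{2,(1,1)} > ⋯ > x_{d,(1,1)} > x_{1,(2,1)} > ⋯ > x_{d,(k₁,k₂)}`,
i.e. `(ℓ, j, i)` precedes `(ℓ', j', i')` lexicographically, where `a = (i, (j, ℓ))`. -/
def varLT (d k₁ k₂ : ℕ) (a b : Fin d × Col k₁ k₂) : Prop :=
  Prod.Lex (· < ·) (Prod.Lex (· < ·) (· < ·))
    (a.2.2, (a.2.1, a.1)) (b.2.2, (b.2.1, b.1))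

/-- `m ≺ m'` in the lexicographic monomial order determined by the variable order:
at the largest variable where the exponents differ, `m` has the smaller exponent. -/
def monLT (d k₁ k₂ : ℕ) (m m' : (Fin d × Col k₁ k₂) →₀ ℕ) : Prop :=
  ∃ v, (∀ w, varLT d k₁ k₂ w v → m w = m' w) ∧ m v < m' v

/-- `m` is the `≺`-leading monomial of `f`. -/
def IsLeadMon (d k₁ k₂ : ℕ) (f : MvP d k₁ k₂) (m : (Fin d × Col k₁ k₂) →₀ ℕ) : Prop :=
  m ∈ f.support ∧ ∀ m' ∈ f.support, m' = m ∨ monLT d k₁ k₂ m' m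

/-- `G` is a Gröbner basis of `I` with respect to the lexicographic order `≺`:
`G` is contained in `I` and for every nonzero `f ∈ I` there is a `g ∈ G` whose
`≺`-leading monomial divides the `≺`-leading monomial of `f`. -/
def IsGB (d k₁ k₂ : ℕ) (G : Set (MvP d k₁ k₂)) (I : Ideal (MvP d k₁ k₂)) : Prop :=
  G ⊆ (I : Set (MvP d k₁ k₂)) ∧ ∀ f ∈ I, f ≠ 0 →
    ∃ g ∈ G, ∃ mg, IsLeadMon d k₁ k₂ g mg ∧
      ∀ mf, IsLeadMon d k₁ k₂ f mf → ∀ x, mg x ≤ mf x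

/-! ### The matrix `D_A` -/

/-- For `A ∈ ℂ^{k₂ × (k₁-1)}`, the `k₂ × (k₁k₂)` matrix `D_A`: its row `r` has entry
`1` in the column indexed by `(1, r)`, entry `A r ℓ` in the column indexed by
`(1+ℓ, r)` for `ℓ ∈ [k₁-1]`, and zeros elsewhere. -/
def DMat (k₁ k₂ : ℕ) (A : Matrix (Fin k₂) (Fin (k₁ - 1)) ℂ) :
    Matrix (Fin k₂) (Col k₁ k₂) ℂ := fun r c =>
  if c.2 = r then
    (if _h : (c.1 : ℕ) = 0 then 1
     else A r ⟨(c.1 : ℕ) - 1, by have := c.1.isLt; omega⟩)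
  else 0

end CI

namespace CI

/-- A spanning family `e` with weights: if every non-normal member reduces modulo `J` to members of
smaller weight, and every normal member is separated from the members of at most its weight by
a functional vanishing on `K`, up to congruence modulo `J`, then `K ≤ J`. -/
lemma le_of_normal_forms {M ι : Type*} [AddCommGroup M] [Module ℂ M] (e : ι → M)
    (he : Submodule.span ℂ (Set.range e) = ⊤) (J K : Submodule ℂ M) (hJK : J ≤ K)
    (ω : ι → ℕ) (Nrm : ι → Prop)
    (h1 : ∀ w, ¬ Nrm w → e w ∈ J ⊔ Submodule.span ℂ (e '' {w' | ω w' < ω w}))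
    (h2 : ∀ w, Nrm w → ∃ φ : M →ₗ[ℂ] ℂ, K ≤ LinearMap.ker φ ∧ φ (e w) ≠ 0 ∧
      ∀ w', ω w' ≤ ω w → φ (e w') = 0 ∨ e w - e w' ∈ J) : K ≤ J := by
  classical
  have hspan : ∀ n w, ω w = n → e w ∈ J ⊔ Submodule.span ℂ (e '' {w | Nrm w}) := by
    intro n
    induction n using Nat.strong_induction_on with
    | _ n ih =>
      intro w hw
      by_cases hN : Nrm w
      · exact Submodule.mem_sup_right (Submodule.subset_span ⟨w, hN, rfl⟩)
      · refine (sup_le_iff.2 ⟨le_sup_left, Submodule.span_le.2 ?_⟩ :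
          J ⊔ Submodule.span ℂ (e '' {w' | ω w' < ω w}) ≤ _) (h1 w hN)
        rintro _ ⟨w', hw', rfl⟩
        exact ih (ω w') (hw ▸ hw') w' rfl
  have hB : ∀ n (p : ι →₀ ℂ), p.support.card = n → (∀ w ∈ p.support, Nrm w) →
      (p.sum fun w a => a • e w) ∈ K → (p.sum fun w a => a • e w) ∈ J := by
    intro n
    induction n using Nat.strong_induction_on with
    | _ n ih =>
      intro p hp hN hK
      rcases p.support.eq_empty_or_nonempty with h0 | hne
      · rw [Finsupp.support_eq_empty.1 h0]; simp
      obtain ⟨w, hw, hmax⟩ := p.support.exists_max_image ω hne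
      obtain ⟨φ, hφK, hφw, hφ⟩ := h2 w (hN w hw)
      set P : ι → Prop := fun w' => e w - e w' ∈ J with hP
      have hsplit : (p.sum fun w a => a • e w) =
          ((p.filter P).sum fun w a => a • e w) +
            ((p.filter fun w' => ¬ P w').sum fun w a => a • e w) := by
        conv_lhs => rw [← Finsupp.filter_add_filter_not p P]
        rw [Finsupp.sum_add_index'] <;> simp [add_smul]
      have hPφ : ∀ w', P w' → φ (e w') = φ (e w) := by
        intro w' h
        have := hφK (hJK h)
        rw [LinearMap.mem_ker, map_sub, sub_eq_zero] at this
        exact this.symm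
      have h3 : φ ((p.filter P).sum fun w a => a • e w) =
          ((p.filter P).sum fun _ a => a) * φ (e w) := by
        rw [Finsupp.sum, Finsupp.sum, map_sum, Finset.sum_mul]
        refine Finset.sum_congr rfl fun w' hw' => ?_
        rw [map_smul, smul_eq_mul, hPφ w' ((Finsupp.mem_support_iff.1 hw').imp_symm
          fun h => Finsupp.filter_apply_neg P p h)]
      have h4 : φ ((p.filter fun w' => ¬ P w').sum fun w a => a • e w) = 0 := by
        rw [Finsupp.sum, map_sum]
        refine Finset.sum_eq_zero fun w' hw' => ?_
        rw [Finsupp.support_filter, Finset.mem_filter] at hw'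
        rw [map_smul, (hφ w' (hmax w' hw'.1)).resolve_right hw'.2, smul_zero]
      have h5 : ((p.filter P).sum fun _ a => a) = 0 := by
        have := hφK hK
        rw [LinearMap.mem_ker, hsplit, map_add, h3, h4, add_zero] at this
        exact (mul_eq_zero.1 this).resolve_right hφw
      have h6 : ((p.filter P).sum fun w a => a • e w) ∈ J := by
        have : ((p.filter P).sum fun w a => a • e w) =
            -((p.filter P).sum fun w' a => a • (e w - e w')) := by
          simp only [Finsupp.sum, smul_sub, Finset.sum_sub_distrib, ← Finset.sum_smul]
          rw [Finsupp.sum] at h5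
          rw [h5]; simp
        rw [this]
        refine J.neg_mem (J.sum_mem fun w' hw' => J.smul_mem _ ?_)
        rw [Finsupp.support_filter, Finset.mem_filter] at hw'
        exact hw'.2
      rw [hsplit] at hK ⊢
      refine J.add_mem h6 (ih _ ?_ _ rfl (fun w' hw' => ?_) ?_)
      · rw [← hp, Finsupp.support_filter]
        refine Finset.card_lt_card (Finset.filter_ssubset.2 ⟨w, hw, ?_⟩)
        simp [hP]
      · rw [Finsupp.support_filter, Finset.mem_filter] at hw'
        exact hN w' hw'.1
      · simpa using K.sub_mem hK (hJK h6)
  intro f hf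
  have htop : f ∈ J ⊔ Submodule.span ℂ (e '' {w | Nrm w}) := by
    have : (⊤ : Submodule ℂ M) ≤ J ⊔ Submodule.span ℂ (e '' {w | Nrm w}) := by
      rw [← he, Submodule.span_le]
      rintro _ ⟨w, rfl⟩
      exact hspan _ w rfl
    exact this trivial
  obtain ⟨j, hj, g, hg, rfl⟩ := Submodule.mem_sup.1 htop
  obtain ⟨p, hp, rfl⟩ := (Finsupp.mem_span_image_iff_linearCombination ℂ).1 hg
  rw [Finsupp.linearCombination_apply] at hf ⊢
  refine J.add_mem hj (hB _ p rfl (fun w hw => ?_) ?_)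
  · exact (Finsupp.mem_supported ℂ p).1 hp hw
  · simpa using K.sub_mem hf (hJK hj)

/-- The strict dominance relation on points with coordinates `row` and `col`. -/
def Dom {α : Type*} (row col : α → ℕ) (x y : α) : Prop := row x < row y ∧ col x < col y

lemma Dom.trans {α : Type*} {row col : α → ℕ} {x y z : α} (h : Dom row col x y)
    (h' : Dom row col y z) : Dom row col x z :=
  ⟨h.1.trans h'.1, h.2.trans h'.2⟩

lemma dom_of_pairwise_dom {α : Type*} {row col : α → ℕ} {C : List α}
    (hC : C.Pairwise (Dom row col)) {x y : α} (hx : x ∈ C) (hy : y ∈ C)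
    (h : row x < row y ∨ col x < col y) : Dom row col x y := by
  let Q : α → α → Prop := fun a b => row a < row b ∨ col a < col b → Dom row col a b
  have hirr : ∀ a, Q a a := fun a h => by simp at h
  have : Std.Symm fun a b => Q a b ∧ Q b a := ⟨fun a b h => ⟨h.2, h.1⟩⟩
  have hR : C.Pairwise fun a b => Q a b ∧ Q b a := hC.imp fun {a b} hab =>
    ⟨fun _ => hab, fun h' => absurd h' (by have := hab.1; have := hab.2; omega)⟩
  exact (List.Pairwise.forall_of_forall (fun z _ => ⟨hirr z, hirr z⟩) hR hx hy).1 h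

/-- Exchange lemma: a chain from `x` to `y` through `Q` and a chain `C` in columns below `y` can be
recombined into a chain starting in `x` and a chain ending in `y`. -/
lemma exists_exchange {α : Type*} (row col : α → ℕ) (y : α) (C : List α)
    (hC : C.Pairwise (Dom row col)) (hCy : ∀ c ∈ C, col c < col y) (Q : List α) :
    ∀ x, (x :: (Q ++ [y])).Pairwise (Dom row col) →
      (∀ c ∈ C, row x < row c → col x < col c) →
      ∃ Q₁ Q₂ C₁ C₂ : List α, Q₁ ⊆ Q ∧ Q₂ ⊆ Q ∧ C₁ ⊆ C ∧ C₂ ⊆ C ∧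
        Q₁.length + Q₂.length = Q.length ∧ C₁.length + C₂.length = C.length ∧
        (x :: (Q₁ ++ C₂)).Pairwise (Dom row col) ∧
        (C₁ ++ (Q₂ ++ [y])).Pairwise (Dom row col) := by
  classical
  have key : ∀ (x d : α) (D : List α), (d :: D).Pairwise (Dom row col) →
      (∀ c ∈ C, ¬ Dom row col c d → Dom row col x c) →
      (x :: C.filter fun c => ¬ Dom row col c d).Pairwise (Dom row col) ∧
        ((C.filter fun c => Dom row col c d) ++ (d :: D)).Pairwise (Dom row col) := by
    intro x d D hD hx
    refine ⟨List.pairwise_cons.2 ⟨fun c hc => ?_, hC.filter _⟩,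
      List.pairwise_append.2 ⟨hC.filter _, hD, fun c hc z hz => ?_⟩⟩
    · rw [List.mem_filter, decide_eq_true_iff] at hc
      exact hx c hc.1 hc.2
    · rw [List.mem_filter, decide_eq_true_iff] at hc
      rcases List.mem_cons.1 hz with rfl | hz
      · exact hc.2
      · exact hc.2.trans ((List.pairwise_cons.1 hD).1 z hz)
  have hlen : ∀ d, (C.filter fun c => Dom row col c d).length +
      (C.filter fun c => ¬ Dom row col c d).length = C.length := by
    intro d
    have := C.length_eq_length_filter_add (fun c => decide (Dom row col c d))
    simp only [decide_not]
    exact this.symm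
  induction Q with
  | nil =>
    intro x hx hH
    have hk := key x y [] (by simp) fun c hc h => by
      have h1 : row x < row y := by simp at hx; exact hx.1
      have h2 : row y ≤ row c := by
        by_contra h3
        exact h ⟨not_le.1 h3, hCy c hc⟩
      exact ⟨h1.trans_le h2, hH c hc (h1.trans_le h2)⟩
    exact ⟨[], [], _, _, by simp, by simp, List.filter_subset_self _, List.filter_subset_self _, rfl,
      hlen y, by simpa using hk.1, by simpa using hk.2⟩
  | cons d Q ih =>
    intro x hx hH
    have hxd : Dom row col x d := (List.pairwise_cons.1 hx).1 d (by simp)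
    have hd : (d :: (Q ++ [y])).Pairwise (Dom row col) := (List.pairwise_cons.1 hx).2
    by_cases hcr : ∃ c ∈ C, row c ≤ row x ∧ col d ≤ col c
    · obtain ⟨c, hc, hcx, hcd⟩ := hcr
      obtain ⟨Q₁, Q₂, C₁, C₂, q1, q2, c1, c2, lQ, lC, p1, p2⟩ := ih d hd fun c' hc' h => by
        have hlt : row c < row c' := lt_of_le_of_lt hcx (hxd.1.trans h)
        exact lt_of_le_of_lt hcd (dom_of_pairwise_dom hC hc hc' (Or.inl hlt)).2
      refine ⟨d :: Q₁, Q₂, C₁, C₂, ?_, ?_, c1, c2, ?_, lC, ?_, p2⟩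
      · exact List.cons_subset_cons d q1
      · exact List.subset_cons_of_subset d q2
      · simp only [List.length_cons]; omega
      · refine List.pairwise_cons.2 ⟨fun z hz => ?_, p1⟩
        rcases List.mem_cons.1 hz with rfl | hz
        · exact hxd
        · exact hxd.trans ((List.pairwise_cons.1 p1).1 z hz)
    · push Not at hcr
      have hk := key x d (Q ++ [y]) hd fun c hc h => by
        by_cases h1 : row x < row c
        · exact ⟨h1, hH c hc h1⟩
        · exact absurd ⟨(not_lt.1 h1).trans_lt hxd.1, hcr c hc (not_lt.1 h1)⟩ h
      exact ⟨[], d :: Q, _, _, by simp, by simp, List.filter_subset_self _, List.filter_subset_self _,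
        by simp, hlen d, by simpa using hk.1, by simpa using hk.2⟩

/-- If the columns come in three consecutive blocks `0, 1, 2`, and chains avoiding one of the outer
blocks have length at most `T`, then a chain meeting both outer blocks and a chain in the middle
block have total length at most `2 * T`. -/
lemma length_add_length_le {α : Type*} (row col typ : α → ℕ) (htyp : ∀ x, typ x ≤ 2)
    (hlt : ∀ x y, typ x < typ y → col x < col y) (T : ℕ)
    (h1 : ∀ L : List α, L.Pairwise (Dom row col) → (∀ x ∈ L, 1 ≤ typ x) → L.length ≤ T)
    (h0 : ∀ L : List α, L.Pairwise (Dom row col) → (∀ x ∈ L, typ x ≤ 1) → L.length ≤ T)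
    (C : List α) (hC : C.Pairwise (Dom row col)) (hC1 : ∀ x ∈ C, typ x = 1)
    (L : List α) (hL : L.Pairwise (Dom row col)) (hL0 : ∃ x ∈ L, typ x = 0)
    (hL2 : ∃ x ∈ L, typ x = 2) : L.length + C.length ≤ 2 * T := by
  obtain ⟨P, hP⟩ : ∃ P, P = L.filter fun x => typ x = 0 := ⟨_, rfl⟩
  obtain ⟨Q, hQ⟩ : ∃ Q, Q = L.filter fun x => typ x = 1 := ⟨_, rfl⟩
  obtain ⟨S, hS⟩ : ∃ S, S = L.filter fun x => typ x = 2 := ⟨_, rfl⟩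
  have mP : ∀ x, x ∈ P ↔ x ∈ L ∧ typ x = 0 := by simp [hP]
  have mQ : ∀ x, x ∈ Q ↔ x ∈ L ∧ typ x = 1 := by simp [hQ]
  have mS : ∀ x, x ∈ S ↔ x ∈ L ∧ typ x = 2 := by simp [hS]
  have hlen : L.length = P.length + Q.length + S.length := by
    rw [hP, hQ, hS]
    clear * - htyp
    induction L with
    | nil => rfl
    | cons a L ih =>
      have := htyp a
      have h : typ a = 0 ∨ typ a = 1 ∨ typ a = 2 := by omega
      rcases h with h | h | h <;> simp [h, ih] <;> omega
  have pP : P.Pairwise (Dom row col) := hP ▸ hL.filter _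
  have pQ : Q.Pairwise (Dom row col) := hQ ▸ hL.filter _
  have pS : S.Pairwise (Dom row col) := hS ▸ hL.filter _
  have hdom : ∀ x ∈ L, ∀ y ∈ L, typ x < typ y → Dom row col x y := fun x hx y hy h =>
    dom_of_pairwise_dom hL hx hy (Or.inr (hlt x y h))
  rcases List.eq_nil_or_concat P with rfl | ⟨P', x, rfl⟩
  · obtain ⟨x, hx⟩ := hL0
    exact absurd ((mP x).2 hx) (by simp)
  rcases S with _ | ⟨y, S'⟩
  · obtain ⟨x, hx⟩ := hL2
    exact absurd ((mS x).2 hx) (by simp)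
  obtain ⟨hxL, hx0⟩ := (mP x).1 (by simp)
  obtain ⟨hyL, hy2⟩ := (mS y).1 (by simp)
  obtain ⟨Q₁, Q₂, C₁, C₂, q1, q2, c1, c2, lQ, lC, p1, p2⟩ :=
    exists_exchange row col y C hC (fun c hc => hlt _ _ (by rw [hC1 c hc, hy2]; omega)) Q x
      (by
        refine List.pairwise_cons.2 ⟨fun z hz => ?_, List.pairwise_append.2
          ⟨pQ, by simp, fun z hz w hw => ?_⟩⟩
        · rcases List.mem_append.1 hz with hz | hz
          · exact hdom x hxL z ((mQ z).1 hz).1 (by rw [((mQ z).1 hz).2]; omega)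
          · rw [List.mem_singleton.1 hz]
            exact hdom x hxL y hyL (by omega)
        · rw [List.mem_singleton.1 hw]
          exact hdom z ((mQ z).1 hz).1 y hyL (by rw [((mQ z).1 hz).2]; omega))
      (fun c hc _ => hlt _ _ (by rw [hC1 c hc, hx0]; omega))
  have ht1 := h0 (P' ++ (x :: (Q₁ ++ C₂)))
    (by
      simp only [List.pairwise_append, List.concat_eq_append] at pP
      refine List.pairwise_append.2 ⟨pP.1, p1, fun z hz w hw => ?_⟩
      have hzx : Dom row col z x := pP.2.2 z hz x (by simp)
      rcases List.mem_cons.1 hw with rfl | hw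
      · exact hzx
      · exact hzx.trans ((List.pairwise_cons.1 p1).1 w hw))
    (by
      intro z hz
      simp only [List.mem_append, List.mem_cons] at hz
      rcases hz with hz | rfl | hz | hz
      · rw [((mP z).1 (by simp [hz])).2]; omega
      · omega
      · rw [((mQ z).1 (q1 hz)).2]
      · rw [hC1 z (c2 hz)])
  have ht2 := h1 ((C₁ ++ (Q₂ ++ [y])) ++ S')
    (by
      refine List.pairwise_append.2 ⟨p2, (List.pairwise_cons.1 pS).2, fun z hz w hw => ?_⟩
      have hyw : Dom row col y w := (List.pairwise_cons.1 pS).1 w hw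
      rw [← List.append_assoc] at hz p2
      rcases List.mem_append.1 hz with hz | hz
      · exact ((List.pairwise_append.1 p2).2.2 z hz y (by simp)).trans hyw
      · rwa [List.mem_singleton.1 hz])
    (by
      intro z hz
      simp only [List.mem_append, List.mem_singleton] at hz
      rcases hz with (hz | hz | rfl) | hz
      · rw [hC1 z (c1 hz)]
      · rw [((mQ z).1 (q2 hz)).2]
      · omega
      · rw [((mS z).1 (by simp [hz])).2]; omega)
  simp only [List.length_append, List.length_cons, List.length_nil, List.concat_eq_append]
    at ht1 ht2 hlen
  omega

/-- The first colour available in a column block. -/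
def colorLo (q typ : ℕ) : ℕ := if typ = 0 then 0 else q

/-- The end of the range of colours available in a column block. -/
def colorHi (q T typ : ℕ) : ℕ := if typ = 2 then q + T else T

/-- Mirsky-type colouring with prescribed colour ranges in three consecutive blocks of columns. -/
lemma exists_coloring {α : Type*} (row col typ : α → ℕ) (htyp : ∀ x, typ x ≤ 2)
    (hlt : ∀ x y, typ x < typ y → col x < col y) (T : ℕ)
    (h1 : ∀ L : List α, L.Pairwise (Dom row col) → (∀ x ∈ L, 1 ≤ typ x) → L.length ≤ T)
    (h0 : ∀ L : List α, L.Pairwise (Dom row col) → (∀ x ∈ L, typ x ≤ 1) → L.length ≤ T) :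
    ∃ (q : ℕ) (C : List α) (c : α → ℕ), C.Pairwise (Dom row col) ∧ (∀ x ∈ C, typ x = 1) ∧
      q + C.length = T ∧ (∀ x y, Dom row col x y → c x < c y) ∧
      ∀ x, colorLo q (typ x) ≤ c x ∧ c x < colorHi q T (typ x) := by
  have hmono : ∀ x y, Dom row col x y → typ x ≤ typ y := fun x y h => by
    by_contra h'
    have := hlt y x (by omega)
    have := h.2
    omega
  obtain ⟨C, hC, hC1, hmax⟩ : ∃ C : List α, C.Pairwise (Dom row col) ∧ (∀ x ∈ C, typ x = 1) ∧
      ∀ L : List α, L.Pairwise (Dom row col) → (∀ x ∈ L, typ x = 1) → L.length ≤ C.length := by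
    let A : Set ℕ := {n | ∃ L : List α, L.Pairwise (Dom row col) ∧ (∀ x ∈ L, typ x = 1) ∧
      L.length = n}
    have hb : BddAbove A := ⟨T, by
      rintro _ ⟨L, hL, hL1, rfl⟩
      exact h1 L hL fun x hx => (hL1 x hx).ge⟩
    obtain ⟨C, hC, hC1, hlen⟩ := Nat.sSup_mem (s := A) ⟨0, [], by simp⟩ hb
    exact ⟨C, hC, hC1, fun L hL hL1 => hlen ▸ le_csSup hb ⟨L, hL, hL1, rfl⟩⟩
  have hCT : C.length ≤ T := h1 C hC fun x hx => (hC1 x hx).ge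
  obtain ⟨q, hq⟩ : ∃ q, q + C.length = T := ⟨T - C.length, by omega⟩
  let V : α → Set ℕ := fun x => {v | ∃ L : List α, (L ++ [x]).Pairwise (Dom row col) ∧
    ∀ y ∈ L ++ [x], v ≤ colorLo q (typ y) + L.length}
  have hV : ∀ x, ∀ v ∈ V x, v < colorHi q T (typ x) := by
    rintro x v ⟨L, hL, hv⟩
    have hle : ∀ y ∈ L ++ [x], typ y ≤ typ x := by
      intro y hy
      rcases List.mem_append.1 hy with hy | hy
      · exact hmono y x ((List.pairwise_append.1 hL).2.2 y hy x (by simp))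
      · rw [List.mem_singleton.1 hy]
    have hlen : (L ++ [x]).length = L.length + 1 := by simp
    by_cases hB : ∃ y ∈ L ++ [x], typ y = 0
    · have hvL : v ≤ L.length := by
        obtain ⟨y, hy, hy0⟩ := hB
        simpa [colorLo, hy0] using hv y hy
      by_cases hx2 : typ x = 2
      · have := length_add_length_le row col typ htyp hlt T h1 h0 C hC hC1 _ hL hB
          ⟨x, by simp, hx2⟩
        simp only [colorHi, hx2, if_true]
        omega
      · have := h0 _ hL fun y hy => (hle y hy).trans (by have := htyp x; omega)
        simp only [colorHi, hx2, if_false]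
        omega
    · push Not at hB
      have hx0 := hB x (by simp)
      have hvL : v ≤ q + L.length := by
        simpa [colorLo, hx0] using hv x (by simp)
      by_cases hx2 : typ x = 2
      · have := h1 _ hL fun y hy => Nat.one_le_iff_ne_zero.2 (hB y hy)
        simp only [colorHi, hx2, if_true]
        omega
      · have := hmax _ hL fun y hy => by
          have := hle y hy
          have := hB y hy
          have := htyp x
          omega
        simp only [colorHi, hx2, if_false]
        omega
  have hbdd : ∀ x, BddAbove (V x) := fun x => ⟨_, fun v hv => (hV x v hv).le⟩
  have hlo : ∀ x, colorLo q (typ x) ∈ V x := fun x => ⟨[], by simp, by simp⟩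
  refine ⟨q, C, fun x => sSup (V x), hC, hC1, hq, fun x y hxy => ?_,
    fun x => ⟨le_csSup (hbdd x) (hlo x), hV x _ (Nat.sSup_mem ⟨_, hlo x⟩ (hbdd x))⟩⟩
  obtain ⟨L, hL, hv⟩ := Nat.sSup_mem ⟨_, hlo x⟩ (hbdd x)
  refine Nat.lt_of_succ_le (le_csSup (hbdd y) ⟨L ++ [x], ?_, fun z hz => ?_⟩)
  · refine List.pairwise_append.2 ⟨hL, by simp, fun z hz w hw => ?_⟩
    rw [List.mem_singleton.1 hw]
    rcases List.mem_append.1 hz with hz | hz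
    · exact ((List.pairwise_append.1 hL).2.2 z hz x (by simp)).trans hxy
    · rwa [List.mem_singleton.1 hz]
  · rw [List.length_append, List.length_singleton, Nat.succ_eq_add_one, ← add_assoc]
    refine Nat.succ_le_succ ?_
    rcases List.mem_append.1 hz with hz | hz
    · exact hv z hz
    · rw [List.mem_singleton.1 hz]
      refine (hv x (by simp)).trans (Nat.add_le_add_right ?_ _)
      have := hmono x y hxy
      unfold colorLo
      split_ifs <;> omega

lemma card_filter_eq_of_map_eq {α β γ : Type*} [Fintype α] [Fintype β] {f : α → γ} {g : β → γ}
    (h : Finset.univ.val.map f = Finset.univ.val.map g) (P : γ → Prop) [DecidablePred P] :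
    (Finset.univ.filter fun a => P (f a)).card = (Finset.univ.filter fun b => P (g b)).card := by
  have := congrArg (Multiset.countP P) h
  rw [Multiset.countP_map, Multiset.countP_map] at this
  exact this

lemma exists_equiv_of_card_fiber_eq {α β γ : Type*} [Fintype α] [Fintype β] [DecidableEq γ]
    (f : α → γ) (g : β → γ)
    (h : ∀ z, (Finset.univ.filter fun a => f a = z).card =
      (Finset.univ.filter fun b => g b = z).card) :
    ∃ σ : α ≃ β, ∀ a, g (σ a) = f a := by
  have e : ∀ z, Nonempty ({a // f a = z} ≃ {b // g b = z}) := fun z => by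
    rw [← Fintype.card_eq, Fintype.card_subtype, Fintype.card_subtype]
    exact h z
  exact ⟨Equiv.ofFiberEquiv fun z => (e z).some, Equiv.ofFiberEquiv_map _⟩

/-- Number of points weakly above and to the right of `(p, q)`. -/
def quadrantCount {α : Type*} [Fintype α] (row col : α → ℕ) (p q : ℕ) : ℕ :=
  (Finset.univ.filter fun x => p ≤ row x ∧ q ≤ col x).card

lemma quadrantCount_eq_sum_inter {α : Type*} [Fintype α] [DecidableEq α] {row col c : α → ℕ}
    {N : ℕ} (hN : ∀ x, c x < N) (p q : ℕ) :
    quadrantCount row col p q = ∑ κ ∈ Finset.range N,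
      ((Finset.univ.filter fun x => p ≤ row x ∧ c x = κ) ∩
        (Finset.univ.filter fun x => c x = κ ∧ q ≤ col x)).card := by
  rw [quadrantCount, Finset.card_eq_sum_card_fiberwise (f := c) (t := Finset.range N)
    (by intro x _; simpa using hN x)]
  refine Finset.sum_congr rfl fun κ _ => congrArg _ ?_
  ext x
  simp only [Finset.mem_filter, Finset.mem_univ, true_and, Finset.mem_inter]
  tauto

lemma quadrantCount_le {α β : Type*} [Fintype α] [Fintype β] {row col c : α → ℕ}
    {row' col' c' : β → ℕ}
    (hr : Finset.univ.val.map (fun x => (row x, c x)) =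
      Finset.univ.val.map fun x => (row' x, c' x))
    (hc : Finset.univ.val.map (fun x => (c x, col x)) =
      Finset.univ.val.map fun x => (c' x, col' x))
    (hanti : ∀ x y, Dom row col x y → c x ≠ c y) (p q : ℕ) :
    quadrantCount row col p q ≤ quadrantCount row' col' p q := by
  classical
  obtain ⟨N, hN, hN'⟩ : ∃ N, (∀ x, c x < N) ∧ ∀ x, c' x < N :=
    ⟨∑ x, c x + ∑ x, c' x + 1, fun x => by
      have := Finset.single_le_sum (f := c) (fun _ _ => Nat.zero_le _) (Finset.mem_univ x)
      omega, fun x => by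
      have := Finset.single_le_sum (f := c') (fun _ _ => Nat.zero_le _) (Finset.mem_univ x)
      omega⟩
  rw [quadrantCount_eq_sum_inter hN, quadrantCount_eq_sum_inter hN']
  refine Finset.sum_le_sum fun κ _ => ?_
  have e1 := card_filter_eq_of_map_eq hr fun z => p ≤ z.1 ∧ z.2 = κ
  have e2 := card_filter_eq_of_map_eq hc fun z => z.1 = κ ∧ q ≤ z.2
  have e3 := card_filter_eq_of_map_eq hc fun z => z.1 = κ
  dsimp only at e1 e2 e3
  set A := Finset.univ.filter fun x => p ≤ row x ∧ c x = κ
  set B := Finset.univ.filter fun x => c x = κ ∧ q ≤ col x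
  set A' := Finset.univ.filter fun x => p ≤ row' x ∧ c' x = κ
  set B' := Finset.univ.filter fun x => c' x = κ ∧ q ≤ col' x
  by_cases hne : (A ∩ B).Nonempty
  · obtain ⟨x, hx⟩ := hne
    simp only [A, B, Finset.mem_inter, Finset.mem_filter, Finset.mem_univ, true_and] at hx
    have hun : Finset.univ.filter (fun x => c x = κ) ⊆ A ∪ B := by
      intro y hy
      simp only [Finset.mem_filter, Finset.mem_univ, true_and] at hy
      simp only [A, B, Finset.mem_union, Finset.mem_filter, Finset.mem_univ, true_and]
      by_contra h
      exact hanti y x ⟨by omega, by omega⟩ (by omega)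
    have hun' : A' ∪ B' ⊆ Finset.univ.filter fun x => c' x = κ := by
      intro y hy
      simp only [A', B', Finset.mem_union, Finset.mem_filter, Finset.mem_univ, true_and] at hy
      simp only [Finset.mem_filter, Finset.mem_univ, true_and]
      tauto
    have := Finset.card_le_card hun
    have := Finset.card_le_card hun'
    have := Finset.card_union_add_card_inter A B
    have := Finset.card_union_add_card_inter A' B'
    omega
  · rw [Finset.not_nonempty_iff_eq_empty.1 hne]
    simp

lemma sum_mul_eq_sum_quadrantCount {α : Type*} [Fintype α] (row col : α → ℕ) (D E : ℕ)
    (hD : ∀ x, row x < D) (hE : ∀ x, col x < E) :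
    ∑ x, (row x + 1) * (col x + 1) =
      ∑ p ∈ Finset.range D, ∑ q ∈ Finset.range E, quadrantCount row col p q := by
  have hcount : ∀ r D, r < D → ((Finset.range D).filter fun p => p ≤ r).card = r + 1 := by
    intro r D h
    have : (Finset.range D).filter (fun p => p ≤ r) = Finset.range (r + 1) := by
      ext p; simp only [Finset.mem_filter, Finset.mem_range]; omega
    rw [this, Finset.card_range]
  simp only [quadrantCount, Finset.card_filter]
  simp_rw [Finset.sum_comm (s := Finset.range E) (t := Finset.univ)]
  rw [Finset.sum_comm]
  refine Finset.sum_congr rfl fun x _ => ?_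
  rw [← hcount _ _ (hD x), ← hcount _ _ (hE x), Finset.card_filter, Finset.card_filter,
    Finset.sum_mul_sum]
  refine Finset.sum_congr rfl fun p _ => Finset.sum_congr rfl fun q _ => ?_
  split_ifs <;> simp_all

lemma card_fiber_add_quadrantCount {α : Type*} [Fintype α] (row col : α → ℕ) (p q : ℕ) :
    (Finset.univ.filter fun x => row x = p ∧ col x = q).card +
      quadrantCount row col p (q + 1) + quadrantCount row col (p + 1) q =
    quadrantCount row col p q + quadrantCount row col (p + 1) (q + 1) := by
  simp only [quadrantCount, Finset.card_filter, ← Finset.sum_add_distrib]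
  refine Finset.sum_congr rfl fun x _ => ?_
  split_ifs <;> omega

/-- Antisorted matchings in each colour class have minimal weight, and are determined by it. -/
lemma exists_equiv_of_weight_le {α β : Type*} [Fintype α] [Fintype β] {row col c : α → ℕ}
    {row' col' c' : β → ℕ}
    (hr : Finset.univ.val.map (fun x => (row x, c x)) =
      Finset.univ.val.map fun x => (row' x, c' x))
    (hc : Finset.univ.val.map (fun x => (c x, col x)) =
      Finset.univ.val.map fun x => (c' x, col' x))
    (hanti : ∀ x y, Dom row col x y → c x ≠ c y)
    (hω : ∑ x, (row' x + 1) * (col' x + 1) ≤ ∑ x, (row x + 1) * (col x + 1)) :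
    ∃ σ : α ≃ β, ∀ x, row' (σ x) = row x ∧ col' (σ x) = col x := by
  obtain ⟨D, hD, hD'⟩ : ∃ D, (∀ x, row x < D ∧ col x < D) ∧ ∀ x, row' x < D ∧ col' x < D := by
    refine ⟨∑ x, (row x + col x) + ∑ x, (row' x + col' x) + 1, fun x => ?_, fun x => ?_⟩
    · have := Finset.single_le_sum (f := fun x => row x + col x) (fun _ _ => Nat.zero_le _)
        (Finset.mem_univ x)
      omega
    · have := Finset.single_le_sum (f := fun x => row' x + col' x) (fun _ _ => Nat.zero_le _)
        (Finset.mem_univ x)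
      omega
  have hle := quadrantCount_le hr hc hanti
  have heq : ∀ p q, quadrantCount row col p q = quadrantCount row' col' p q := by
    rw [sum_mul_eq_sum_quadrantCount row col D D (fun x => (hD x).1) fun x => (hD x).2,
      sum_mul_eq_sum_quadrantCount row' col' D D (fun x => (hD' x).1) fun x => (hD' x).2] at hω
    intro p q
    by_cases hpq : p < D ∧ q < D
    · by_contra hne
      refine absurd hω (not_le.2 ?_)
      refine Finset.sum_lt_sum (fun p _ => Finset.sum_le_sum fun q _ => hle p q)
        ⟨p, Finset.mem_range.2 hpq.1, Finset.sum_lt_sum (fun q _ => hle p q)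
          ⟨q, Finset.mem_range.2 hpq.2, lt_of_le_of_ne (hle p q) hne⟩⟩
    · have h1 : quadrantCount row col p q = 0 :=
        Finset.card_eq_zero.2 (Finset.filter_eq_empty_iff.2 fun x _ => by have := hD x; omega)
      have h2 : quadrantCount row' col' p q = 0 :=
        Finset.card_eq_zero.2 (Finset.filter_eq_empty_iff.2 fun x _ => by have := hD' x; omega)
      rw [h1, h2]
  obtain ⟨σ, hσ⟩ := exists_equiv_of_card_fiber_eq (fun x => (row x, col x))
    (fun x => (row' x, col' x)) fun z => by
      have h1 := card_fiber_add_quadrantCount row col z.1 z.2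
      have h2 := card_fiber_add_quadrantCount row' col' z.1 z.2
      simp only [heq] at h1
      simp only [Prod.ext_iff]
      omega
  exact ⟨σ, fun x => Prod.ext_iff.1 (hσ x)⟩
lemma det_eq_zero_of_card_lt {R ι : Type*} [CommRing R] [Fintype ι] {r : ℕ}
    (h : Fintype.card ι < r) (A : Matrix (Fin r) ι R) (B : Matrix ι (Fin r) R) :
    (A * B).det = 0 := by
  classical
  obtain ⟨e⟩ : Nonempty (Fin r ≃ ι ⊕ Fin (r - Fintype.card ι)) := by
    rw [← Fintype.card_eq]; simp; omega
  have : A * B = ((Matrix.fromCols A (0 : Matrix _ (Fin (r - Fintype.card ι)) R)).submatrix id e) *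
      ((Matrix.fromRows B 0).submatrix e id) := by
    rw [Matrix.submatrix_mul_equiv, Matrix.fromCols_mul_fromRows]
    simp
  rw [this, Matrix.det_mul, Matrix.det_eq_zero_of_column_eq_zero
    (e.symm (Sum.inr ⟨0, by omega⟩)) (by simp), zero_mul]

lemma det_sum_mul_eq_zero {R κ : Type*} [CommRing R] {r : ℕ} (I : Finset κ) (h : I.card < r)
    (A : Fin r → κ → R) (B : κ → Fin r → R) :
    (Matrix.of fun i j => ∑ k ∈ I, A i k * B k j).det = 0 := by
  rw [← det_eq_zero_of_card_lt (ι := I) (by simpa using h) (Matrix.of fun i k => A i k)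
    (Matrix.of fun k j => B k j)]
  congr 1
  ext i j
  simp [Matrix.mul_apply, Finset.sum_attach I fun k => A i k * B k j]

/-- The polynomial ring is spanned by the words in its variables. -/
lemma span_range_prod_X (σ : Type*) :
    Submodule.span ℂ (Set.range fun w : (n : ℕ) × (Fin n → σ) =>
      ∏ l, (X (w.2 l) : MvPolynomial σ ℂ)) = ⊤ := by
  rw [eq_top_iff, ← Algebra.top_toSubmodule, ← MvPolynomial.adjoin_range_X,
    Algebra.adjoin_eq_span]
  refine Submodule.span_mono fun f hf => ?_
  obtain ⟨l, hl, rfl⟩ := Submonoid.exists_list_of_mem_closure hf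
  choose g hg using hl
  refine ⟨⟨l.length, fun k => g (l.get k) (l.get_mem k)⟩, ?_⟩
  simp only [hg]
  rw [← List.prod_ofFn, List.ofFn_get]

/-- The weight of a word, with respect to a numbering `pos` of the columns. -/
def weight {d n : ℕ} {γ : Type*} (pos : γ → ℕ) (w : Fin n → Fin d × γ) : ℕ :=
  ∑ l, (((w l).1 : ℕ) + 1) * (pos (w l).2 + 1)

/-- A word whose subword at `g` is the diagonal of a minor in `I` reduces to words of
smaller weight. -/
lemma prod_X_mem_sup_span {d k₁ k₂ n m : ℕ} (I : Ideal (MvP d k₁ k₂)) (pos : Col k₁ k₂ → ℕ)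
    (w : Fin n → Fin d × Col k₁ k₂) (g : Fin m → Fin n)
    (hrow : StrictMono fun k => (w (g k)).1) (hcol : StrictMono fun k => pos (w (g k)).2)
    (hI : minorPoly d k₁ k₂ m (fun k => (w (g k)).1) (fun k => (w (g k)).2) ∈ I) :
    ∏ l, (X (w l) : MvP d k₁ k₂) ∈ I.restrictScalars ℂ ⊔
      Submodule.span ℂ ((fun w : (n : ℕ) × (Fin n → Fin d × Col k₁ k₂) =>
        ∏ l, (X (w.2 l) : MvP d k₁ k₂)) '' {w' | weight pos w'.2 < weight pos w}) := by
  classical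
  have hg : Function.Injective g := fun x y h => hrow.injective (by simp [h])
  let γ : Fin m ↪ Fin n := ⟨g, hg⟩
  let rest : MvP d k₁ k₂ := ∏ l ∈ (Finset.univ.map γ)ᶜ, X (w l)
  let wσ : Equiv.Perm (Fin m) → Fin n → Fin d × Col k₁ k₂ :=
    fun σ l => ((w (σ.viaFintypeEmbedding γ l)).1, (w l).2)
  have hin : ∀ σ k, wσ σ (g k) = ((w (g (σ k))).1, (w (g k)).2) := fun σ k => by
    have := σ.viaFintypeEmbedding_apply_image γ k
    simp only [wσ]
    exact congrArg (fun z => ((w z).1, (w (g k)).2)) this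
  have hout : ∀ σ, ∀ l ∈ (Finset.univ.map γ)ᶜ, wσ σ l = w l := fun σ l hl => by
    have : l ∉ Set.range γ := by simpa using hl
    simp only [wσ, σ.viaFintypeEmbedding_apply_notMem_range γ this]
  have hprod : ∀ σ, ∏ l, (X (wσ σ l) : MvP d k₁ k₂) =
      (∏ k, X ((w (g (σ k))).1, (w (g k)).2)) * rest := fun σ => by
    rw [← Finset.prod_mul_prod_compl (Finset.univ.map γ), Finset.prod_map]
    exact congrArg₂ _ (Finset.prod_congr rfl fun k _ => congrArg X (hin σ k))
      (Finset.prod_congr rfl fun l hl => congrArg X (hout σ l hl))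
  have hw1 : wσ 1 = w := by
    funext l
    by_cases hl : l ∈ (Finset.univ.map γ)ᶜ
    · exact hout 1 l hl
    · obtain ⟨k, rfl⟩ : ∃ k, g k = l := by simpa [γ] using hl
      exact hin 1 k
  have hweight : ∀ σ, σ ≠ 1 → weight pos (wσ σ) < weight pos w := fun σ hσ => by
    simp only [weight]
    rw [← Finset.sum_add_sum_compl (Finset.univ.map γ),
      ← Finset.sum_add_sum_compl (Finset.univ.map γ) fun l =>
        (((w l).1 : ℕ) + 1) * (pos (w l).2 + 1), Finset.sum_map, Finset.sum_map]
    refine add_lt_add_of_lt_of_le ?_ (Finset.sum_le_sum fun l hl => by rw [hout σ l hl])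
    have hmono : StrictMono fun k => (((w (g k)).1 : ℕ) + 1) := fun a b h =>
      Nat.succ_lt_succ (hrow h)
    have hmono' : StrictMono fun k => pos (w (g k)).2 + 1 := fun a b h =>
      Nat.succ_lt_succ (hcol h)
    have := (Monovary.sum_comp_perm_mul_lt_sum_mul_iff (σ := σ)
      (hmono.monotone.monovary hmono'.monotone)).2 fun h => hσ ?_
    · calc _ = _ := Finset.sum_congr rfl fun k _ => ?_
        _ < _ := this
      change ((wσ σ (g k)).1.val + 1) * (pos (wσ σ (g k)).2 + 1) = _
      rw [hin]
    · have h2 : Monotone σ := fun a b hab => by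
        rcases hab.eq_or_lt with rfl | hab
        · rfl
        · exact hmono.le_iff_le.1 (h (hmono' hab))
      have h3 : StrictMono σ := h2.strictMono_of_injective σ.injective
      ext k
      exact congrArg Fin.val (congrFun (h3.range_inj strictMono_id |>.1 (by simp)) k)
  have hdet : minorPoly d k₁ k₂ m (fun k => (w (g k)).1) (fun k => (w (g k)).2) * rest =
      ∏ l, X (w l) + ∑ σ ∈ Finset.univ.erase (1 : Equiv.Perm (Fin m)),
        Equiv.Perm.sign σ • ∏ l, X (wσ σ l) := by
    have h1 : ∏ l, (X (w l) : MvP d k₁ k₂) =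
      Equiv.Perm.sign (1 : Equiv.Perm (Fin m)) • ∏ l, X (wσ 1 l) := by simp [hw1]
    rw [h1, Finset.add_sum_erase _
      (fun σ => Equiv.Perm.sign σ • ∏ l, (X (wσ σ l) : MvP d k₁ k₂)) (Finset.mem_univ 1), minorPoly, Matrix.det_apply,
      Finset.sum_mul]
    refine Finset.sum_congr rfl fun σ _ => ?_
    rw [hprod, smul_mul_assoc]
    rfl
  rw [eq_sub_of_add_eq hdet.symm]
  refine Submodule.sub_mem _ (Submodule.mem_sup_left ?_) (Submodule.mem_sup_right ?_)
  · exact I.mul_mem_right _ hI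
  · refine Submodule.sum_mem _ fun σ hσ => ?_
    have hm := Submodule.subset_span (R := ℂ) (s := (fun w : (n : ℕ) × (Fin n → Fin d × Col k₁ k₂) =>
        ∏ l, (X (w.2 l) : MvP d k₁ k₂)) '' {w' | weight pos w'.2 < weight pos w})
      ⟨⟨n, wσ σ⟩, hweight σ (Finset.ne_of_mem_erase hσ), rfl⟩
    rcases Int.units_eq_one_or (Equiv.Perm.sign σ) with h | h
    · simpa [h] using hm
    · simpa [h, Units.smul_def] using hm

/-- Permuting the second labels of a product within the classes of equal third labels does not
change the product modulo an ideal containing the corresponding binomials. -/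
lemma prod_sub_prod_comp_perm_mem {R D P A : Type*} [CommRing R] {n : ℕ} (I : Ideal R)
    (F : D → P → A → R) (i : Fin n → D) (a : Fin n → A) (ρ : Fin n → P)
    (hI : ∀ l l', a l = a l' → ∀ i i',
      F i (ρ l) (a l) * F i' (ρ l') (a l) - F i (ρ l') (a l) * F i' (ρ l) (a l) ∈ I)
    (π : Equiv.Perm (Fin n)) (hπ : ∀ l, a (π l) = a l) :
    ∏ l, F (i l) (ρ l) (a l) - ∏ l, F (i l) (ρ (π l)) (a l) ∈ I := by
  induction hN : π.support.card using Nat.strong_induction_on generalizing π with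
  | _ N ih =>
    by_cases h1 : π = 1
    · simp [h1]
    obtain ⟨x, hx⟩ : ∃ x, π x ≠ x := by
      by_contra! h
      exact h1 (Equiv.ext h)
    set y := π.symm x with hy
    have hyx : π y = x := by simp [hy]
    have hne : y ≠ x := fun h => hx (h ▸ hyx)
    have hay : a y = a x := by rw [← hπ y, hyx]
    have ha' : ∀ l, a ((Equiv.swap x (π x) * π) l) = a l := fun l => by
      rw [Equiv.Perm.mul_apply, Equiv.swap_apply_def]
      split_ifs with h h'
      · rw [hπ, ← h, hπ]
      · rw [← π.injective h']
      · exact hπ l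
    have key := ih _ (hN ▸ Equiv.Perm.card_support_swap_mul hx) _ ha' rfl
    have hxy : ∀ f : Fin n → R, ∏ l, f l = f x * f y * ∏ l ∈ Finset.univ \ {x, y}, f l := by
      intro f
      rw [← Finset.prod_pair hne.symm, mul_comm, Finset.prod_sdiff (Finset.subset_univ _)]
    have hrest : ∏ l ∈ Finset.univ \ {x, y}, F (i l) (ρ ((Equiv.swap x (π x) * π) l)) (a l) =
        ∏ l ∈ Finset.univ \ {x, y}, F (i l) (ρ (π l)) (a l) := by
      refine Finset.prod_congr rfl fun l hl => ?_
      simp only [Finset.mem_sdiff, Finset.mem_univ, true_and, Finset.mem_insert,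
        Finset.mem_singleton, not_or] at hl
      rw [Equiv.Perm.mul_apply, Equiv.swap_apply_of_ne_of_ne
        (fun h => hl.2 (π.injective (h.trans hyx.symm))) (fun h => hl.1 (π.injective h))]
    have hstep : ∏ l, F (i l) (ρ ((Equiv.swap x (π x) * π) l)) (a l) -
        ∏ l, F (i l) (ρ (π l)) (a l) ∈ I := by
      rw [hxy, hxy fun l => F (i l) (ρ (π l)) (a l), hrest, ← sub_mul]
      refine I.mul_mem_right _ ?_
      simp only [Equiv.Perm.mul_apply, Equiv.swap_apply_right, hyx, Equiv.swap_apply_left, hay]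
      simpa using hI x (π x) (hπ x).symm (i x) (i y)
    simpa using I.add_mem key hstep

/-- The parameters `y_{i,k}`, `z_{k,a}`, `s_{ρ,a}`. -/
abbrev ParVar (d k₂ : ℕ) := (Fin d × ℕ) ⊕ (ℕ × Fin k₂) ⊕ (Fin 2 × Fin k₂)

/-- The exponent of `y_{i,k} z_{k,a} s_{ρ,a}`. -/
def parMon {d k₂ : ℕ} (x : Fin d × Col 2 k₂) (k : ℕ) : ParVar d k₂ →₀ ℕ :=
  Finsupp.single (Sum.inl (x.1, k)) 1 + Finsupp.single (Sum.inr (Sum.inl (k, x.2.2))) 1 +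
    Finsupp.single (Sum.inr (Sum.inr x.2)) 1

open Classical in
/-- The parametrization `x_{i,(ρ,a)} ↦ ∑_{lo a ≤ k < hi a} y_{i,k} z_{k,a} s_{ρ,a}`, with the
columns in `S` sent to zero. -/
def par {d k₂ : ℕ} (S : Set (Col 2 k₂)) (lo hi : Fin k₂ → ℕ) :
    MvP d 2 k₂ →ₐ[ℂ] MvPolynomial (ParVar d k₂) ℂ :=
  aeval fun x => if x.2 ∈ S then 0 else
    ∑ k ∈ Finset.Ico (lo x.2.2) (hi x.2.2), monomial (parMon x k) 1

lemma monomial_parMon {d k₂ : ℕ} (x : Fin d × Col 2 k₂) (k : ℕ) :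
    (monomial (parMon x k) 1 : MvPolynomial (ParVar d k₂) ℂ) =
      X (Sum.inl (x.1, k)) * X (Sum.inr (Sum.inl (k, x.2.2))) * X (Sum.inr (Sum.inr x.2)) := by
  simp only [parMon, X, monomial_mul, mul_one]

open Classical in
lemma par_X {d k₂ : ℕ} (S : Set (Col 2 k₂)) (lo hi : Fin k₂ → ℕ) (x : Fin d × Col 2 k₂) :
    par S lo hi (X x) = if x.2 ∈ S then 0 else
      ∑ k ∈ Finset.Ico (lo x.2.2) (hi x.2.2), monomial (parMon x k) 1 := by
  simp only [par, aeval_X]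

/-- Minors whose columns are combinations of too few vectors are killed by the
parametrization. -/
lemma par_minorPoly_eq_zero {d k₂ r : ℕ} (S : Set (Col 2 k₂)) (lo hi : Fin k₂ → ℕ)
    (a : Fin r → Fin d) (b : Fin r → Col 2 k₂) (I : Finset ℕ) (hI : I.card < r)
    (hb : ∀ j, b j ∉ S → Finset.Ico (lo (b j).2) (hi (b j).2) ⊆ I) :
    par S lo hi (minorPoly d 2 k₂ r a b) = 0 := by
  classical
  rw [minorPoly, AlgHom.map_det, ← det_sum_mul_eq_zero I hI (fun i k => X (Sum.inl (a i, k)))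
    fun k j => if b j ∉ S ∧ k ∈ Finset.Ico (lo (b j).2) (hi (b j).2) then
      (X (Sum.inr (Sum.inl (k, (b j).2))) * X (Sum.inr (Sum.inr (b j))) :
        MvPolynomial (ParVar d k₂) ℂ) else 0]
  congr 1
  ext1 i j
  simp only [AlgHom.mapMatrix_apply, Matrix.map_apply, Matrix.of_apply, par_X]
  split_ifs with h
  · simp [h]
  · simp only [h, not_false_iff, true_and, mul_ite, mul_zero]
    rw [← Finset.sum_filter, Finset.filter_mem_eq_inter, Finset.inter_eq_right.2 (hb j h)]
    exact Finset.sum_congr rfl fun k _ => by rw [monomial_parMon]; ring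

lemma par_minorPoly_two_eq_zero {d k₂ : ℕ} (S : Set (Col 2 k₂)) (lo hi : Fin k₂ → ℕ)
    (a : Fin 2 → Fin d) (b : Fin 2 → Col 2 k₂) (hb : (b 0).2 = (b 1).2) :
    par S lo hi (minorPoly d 2 k₂ 2 a b) = 0 := by
  classical
  have h : ∀ x : Fin d × Col 2 k₂, par S lo hi (X x) =
      (∑ k ∈ Finset.Ico (lo x.2.2) (hi x.2.2),
        X (Sum.inl (x.1, k)) * X (Sum.inr (Sum.inl (k, x.2.2)))) *
      if x.2 ∈ S then 0 else X (Sum.inr (Sum.inr x.2)) := fun x => by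
    rw [par_X, mul_ite, mul_zero, Finset.sum_mul]
    simp only [monomial_parMon]
  rw [minorPoly, Matrix.det_fin_two]
  simp only [Matrix.of_apply, map_sub, map_mul, h, hb]
  ring

/-- The coefficients of the image of a word count its colourings. -/
lemma coeff_par_prod_X {d k₂ n : ℕ} (S : Set (Col 2 k₂)) (lo hi : Fin k₂ → ℕ)
    (w : Fin n → Fin d × Col 2 k₂) (hw : ∀ l, (w l).2 ∉ S) (μ : ParVar d k₂ →₀ ℕ) :
    coeff μ (par S lo hi (∏ l, X (w l))) =
      (((Fintype.piFinset fun l => Finset.Ico (lo (w l).2.2) (hi (w l).2.2)).filter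
        fun c => ∑ l, parMon (w l) (c l) = μ).card : ℂ) := by
  classical
  simp only [map_prod, par_X, hw, if_false]
  rw [Finset.prod_univ_sum, coeff_sum, Finset.card_filter]
  push_cast
  refine Finset.sum_congr rfl fun c _ => ?_
  rw [← monomial_sum_one, coeff_monomial]

lemma par_prod_X_eq_zero {d k₂ n : ℕ} (S : Set (Col 2 k₂)) (lo hi : Fin k₂ → ℕ)
    (w : Fin n → Fin d × Col 2 k₂) {l : Fin n} (hl : (w l).2 ∈ S) :
    par S lo hi (∏ l, X (w l)) = 0 := by
  rw [map_prod]
  exact Finset.prod_eq_zero (Finset.mem_univ l) (by simp [par_X, hl])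

lemma map_eq_map_of_card_eq {α β γ : Type*} [Fintype α] [Fintype β] [DecidableEq γ] (f : α → γ)
    (g : β → γ) (h : ∀ z, (Finset.univ.filter fun a => f a = z).card =
      (Finset.univ.filter fun b => g b = z).card) :
    Finset.univ.val.map f = Finset.univ.val.map g := by
  obtain ⟨σ, hσ⟩ := exists_equiv_of_card_fiber_eq f g h
  rw [← Finset.map_univ_equiv σ, Finset.map_val, Multiset.map_map]
  exact Multiset.map_congr rfl fun a _ => (hσ a).symm

section

variable {d k₂ n : ℕ} (w : Fin n → Fin d × Col 2 k₂) (c : Fin n → ℕ)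

lemma sum_parMon_inl (z : Fin d × ℕ) : (∑ l, parMon (w l) (c l)) (Sum.inl z) =
    (Finset.univ.filter fun l => ((w l).1, c l) = z).card := by
  simp [parMon, Finsupp.finsetSum_apply, Finsupp.single_apply]

lemma sum_parMon_inr_inl (z : ℕ × Fin k₂) :
    (∑ l, parMon (w l) (c l)) (Sum.inr (Sum.inl z)) =
      (Finset.univ.filter fun l => (c l, (w l).2.2) = z).card := by
  simp [parMon, Finsupp.finsetSum_apply, Finsupp.single_apply]

lemma sum_parMon_inr_inr (z : Col 2 k₂) :
    (∑ l, parMon (w l) (c l)) (Sum.inr (Sum.inr z)) =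
      (Finset.univ.filter fun l => (w l).2 = z).card := by
  simp [parMon, Finsupp.finsetSum_apply, Finsupp.single_apply]

end

open Classical in
/-- The block of a column: `0` if its first entry is in `S`, otherwise `2` or `1` according to
whether its second entry is in `S`. -/
def typ {k₂ : ℕ} (S : Set (Col 2 k₂)) (a : Fin k₂) : ℕ :=
  if (0, a) ∈ S then 0 else if (1, a) ∈ S then 2 else 1

/-- The numbering of the columns, ordered by blocks. -/
def pos {k₂ : ℕ} (S : Set (Col 2 k₂)) (p : Col 2 k₂) : ℕ := typ S p.2 * k₂ + p.2

section

variable {k₂ : ℕ} {S : Set (Col 2 k₂)}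

lemma typ_le_two (a : Fin k₂) : typ S a ≤ 2 := by
  unfold typ; split_ifs <;> omega

lemma typ_eq_one_iff {a : Fin k₂} : typ S a = 1 ↔ colOK k₂ S a := by
  unfold typ colOK
  rw [Fin.forall_fin_two]
  split_ifs <;> simp_all

lemma fst_eq_one_of_typ_eq_zero {p : Col 2 k₂} (hp : p ∉ S) (h : typ S p.2 = 0) : p.1 = 1 := by
  obtain ⟨ρ, a⟩ := p
  by_contra hρ
  obtain rfl : ρ = 0 := by simp only at hρ; omega
  simp only [typ] at h
  split_ifs at h
  simp_all

lemma fst_eq_zero_of_typ_eq_two {p : Col 2 k₂} (hp : p ∉ S) (h : typ S p.2 = 2) : p.1 = 0 := by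
  obtain ⟨ρ, a⟩ := p
  by_contra hρ
  obtain rfl : ρ = 1 := by simp only at hρ; omega
  simp only [typ] at h
  split_ifs at h
  simp_all

lemma pos_lt_pos {p p' : Col 2 k₂} (h : typ S p.2 < typ S p'.2) : pos S p < pos S p' := by
  have h1 := p.2.isLt
  have h2 : (typ S p.2 + 1) * k₂ ≤ typ S p'.2 * k₂ := Nat.mul_le_mul_right _ h
  rw [add_mul] at h2
  simp only [pos]
  omega

lemma snd_eq_of_pos_eq {p p' : Col 2 k₂} (h : pos S p = pos S p') : p.2 = p'.2 := by
  rcases lt_trichotomy (typ S p.2) (typ S p'.2) with h' | h' | h'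
  · exact absurd h (pos_lt_pos h').ne
  · simp only [pos, h'] at h
    exact Fin.ext (by omega)
  · exact absurd h (pos_lt_pos h').ne'

lemma mem_of_one_le_typ {p : Col 2 k₂} (hp : p ∉ S) (h : 1 ≤ typ S p.2) :
    p ∈ (rowSlice 2 k₂ 0 \ S) ∪ CSet k₂ S := by
  have := typ_le_two (S := S) p.2
  rcases (by omega : typ S p.2 = 1 ∨ typ S p.2 = 2) with h | h
  · exact Or.inr (typ_eq_one_iff.1 h)
  · exact Or.inl ⟨fst_eq_zero_of_typ_eq_two hp h, hp⟩

lemma mem_of_typ_le_one {p : Col 2 k₂} (hp : p ∉ S) (h : typ S p.2 ≤ 1) :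
    p ∈ (rowSlice 2 k₂ 1 \ S) ∪ CSet k₂ S := by
  rcases (by omega : typ S p.2 = 1 ∨ typ S p.2 = 0) with h | h
  · exact Or.inr (typ_eq_one_iff.1 h)
  · exact Or.inl ⟨fst_eq_one_of_typ_eq_zero hp h, hp⟩

lemma one_le_typ_of_mem {p : Col 2 k₂} (hp : p ∈ (rowSlice 2 k₂ 0 \ S) ∪ CSet k₂ S)
    (hpS : p ∉ S) : 1 ≤ typ S p.2 := by
  rcases hp with hp | hp
  · by_contra h
    have h1 := fst_eq_one_of_typ_eq_zero hpS (by omega)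
    have h2 : p.1 = 0 := hp.1
    simp [h1] at h2
  · exact (typ_eq_one_iff.2 hp).ge

lemma typ_le_one_of_mem {p : Col 2 k₂} (hp : p ∈ (rowSlice 2 k₂ 1 \ S) ∪ CSet k₂ S)
    (hpS : p ∉ S) : typ S p.2 ≤ 1 := by
  rcases hp with hp | hp
  · by_contra h
    have := typ_le_two (S := S) p.2
    have h1 := fst_eq_zero_of_typ_eq_two hpS (by omega)
    have h2 : p.1 = 1 := hp.1
    simp [h1] at h2
  · exact (typ_eq_one_iff.2 hp).le

/-- The elements of `F_S`, case by case. -/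
lemma ISIdeal_le_iff {d t : ℕ} {I : Ideal (MvP d 2 k₂)} : ISIdeal d k₂ t S ≤ I ↔
    minorSet d 2 k₂ 1 S ⊆ I ∧
    (∀ j, colOK k₂ S j → minorSet d 2 k₂ 2 (colSlice 2 k₂ j) ⊆ I) ∧
    (tCond k₂ S → minorSet d 2 k₂ (t - 1) (CSet k₂ S) ⊆ I) ∧
    minorSet d 2 k₂ t ((rowSlice 2 k₂ 0 \ S) ∪ CSet k₂ S) ⊆ I ∧
    minorSet d 2 k₂ t ((rowSlice 2 k₂ 1 \ S) ∪ CSet k₂ S) ⊆ I := by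
  simp only [ISIdeal, FSset, Ideal.span_le, Set.union_subset_iff, Set.iUnion_subset_iff,
    Set.mem_ofPred_eq, and_assoc]

lemma X_mem_of_minorSet_one_subset {d k₁ k₂ : ℕ} {I : Ideal (MvP d k₁ k₂)}
    {U : Set (Col k₁ k₂)} (h : minorSet d k₁ k₂ 1 U ⊆ I) (i : Fin d) {p : Col k₁ k₂}
    (hp : p ∈ U) : (X (i, p) : MvP d k₁ k₂) ∈ I :=
  h ⟨fun _ => i, fun _ => p, Function.injective_of_subsingleton _,
    Function.injective_of_subsingleton _, fun _ => hp, by simp [minorPoly]⟩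

lemma binomial_mem_of_minorSet_two_subset {d k₁ k₂ : ℕ} {I : Ideal (MvP d k₁ k₂)}
    {U : Set (Col k₁ k₂)} (h : minorSet d k₁ k₂ 2 U ⊆ I) (i i' : Fin d) {p p' : Col k₁ k₂}
    (hp : p ∈ U) (hp' : p' ∈ U) :
    (X (i, p) * X (i', p') - X (i, p') * X (i', p) : MvP d k₁ k₂) ∈ I := by
  by_cases hi : i = i'
  · rw [hi, mul_comm, sub_self]; exact I.zero_mem
  by_cases hpp : p = p'
  · rw [hpp, sub_self]; exact I.zero_mem
  refine h ⟨![i, i'], ![p, p'], ?_, ?_, ?_, ?_⟩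
  · intro x y; fin_cases x <;> fin_cases y <;> simp [hi, Ne.symm hi]
  · intro x y; fin_cases x <;> fin_cases y <;> simp [hpp, Ne.symm hpp]
  · simp [Fin.forall_fin_two, hp, hp']
  · simp [minorPoly, Matrix.det_fin_two]

end

section

variable {d k₂ t : ℕ} {S : Set (Col 2 k₂)}

lemma ISIdeal_le_ker_par {q : ℕ} (ht : 2 ≤ t) (hqS : tCond k₂ S → 1 ≤ q) :
    ISIdeal d k₂ t S ≤ RingHom.ker (par S (fun a => colorLo q (typ S a))
      fun a => colorHi q (t - 1) (typ S a) : MvP d 2 k₂ →ₐ[ℂ] _) := by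
  rw [ISIdeal_le_iff]
  refine ⟨?_, fun j _ => ?_, fun hS => ?_, ?_, ?_⟩
  · rintro _ ⟨a, b, -, -, hb, rfl⟩
    exact par_minorPoly_eq_zero _ _ _ a b ∅ (by simp) fun j hj => absurd (hb j) hj
  · rintro _ ⟨a, b, -, -, hb, rfl⟩
    exact par_minorPoly_two_eq_zero _ _ _ a b ((hb 0).trans (hb 1).symm)
  · rintro _ ⟨a, b, -, -, hb, rfl⟩
    have := hqS hS
    refine par_minorPoly_eq_zero _ _ _ a b (Finset.Ico q (t - 1)) (by simp; omega)
      fun j _ => ?_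
    rw [typ_eq_one_iff.2 (hb j)]
    simp [colorLo, colorHi]
  · rintro _ ⟨a, b, -, -, hb, rfl⟩
    refine par_minorPoly_eq_zero _ _ _ a b (Finset.Ico q (q + (t - 1))) (by simp; omega)
      fun j hj => ?_
    have := one_le_typ_of_mem (hb j) hj
    rw [colorLo, if_neg (by omega), colorHi]
    exact Finset.Ico_subset_Ico le_rfl (by split_ifs <;> omega)
  · rintro _ ⟨a, b, -, -, hb, rfl⟩
    refine par_minorPoly_eq_zero _ _ _ a b (Finset.Ico 0 (t - 1)) (by simp; omega)
      fun j hj => ?_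
    have := typ_le_one_of_mem (hb j) hj
    rw [colorHi, if_neg (by omega)]
    exact Finset.Ico_subset_Ico (Nat.zero_le _) le_rfl

/-- Dominance of the letters of a word. -/
abbrev WDom (S : Set (Col 2 k₂)) {n : ℕ} (w : Fin n → Fin d × Col 2 k₂) :
    Fin n → Fin n → Prop :=
  Dom (fun l => ((w l).1 : ℕ)) fun l => pos S (w l).2

/-- Words not divisible by a leading term of `F_S`. -/
structure IsNormal (t : ℕ) (S : Set (Col 2 k₂)) {n : ℕ} (w : Fin n → Fin d × Col 2 k₂) :
    Prop where
  notMem : ∀ l, (w l).2 ∉ S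
  length_lt_of_one_le : ∀ L : List (Fin n), L.Pairwise (WDom S w) →
    (∀ l ∈ L, 1 ≤ typ S (w l).2.2) → L.length < t
  length_lt_of_le_one : ∀ L : List (Fin n), L.Pairwise (WDom S w) →
    (∀ l ∈ L, typ S (w l).2.2 ≤ 1) → L.length < t
  length_lt_of_eq_one : tCond k₂ S → ∀ L : List (Fin n), L.Pairwise (WDom S w) →
    (∀ l ∈ L, typ S (w l).2.2 = 1) → L.length < t - 1

lemma prod_X_mem_sup_span_of_chain {n m : ℕ} (I : Ideal (MvP d 2 k₂))
    (w : Fin n → Fin d × Col 2 k₂) (L : List (Fin n)) (hL : L.Pairwise (WDom S w))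
    (U : Set (Col 2 k₂)) (hU : ∀ l ∈ L, (w l).2 ∈ U) (hI : minorSet d 2 k₂ m U ⊆ I)
    (hm : m ≤ L.length) :
    ∏ l, (X (w l) : MvP d 2 k₂) ∈ I.restrictScalars ℂ ⊔
      Submodule.span ℂ ((fun w : (n : ℕ) × (Fin n → Fin d × Col 2 k₂) =>
        ∏ l, (X (w.2 l) : MvP d 2 k₂)) '' {w' | weight (pos S) w'.2 < weight (pos S) w}) := by
  have hlt : ∀ k k' : Fin m, k < k' →
      WDom S w (L.get (Fin.castLE hm k)) (L.get (Fin.castLE hm k')) := fun k k' h =>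
    List.pairwise_iff_get.1 hL _ _ h
  have hrow : StrictMono fun k : Fin m => (w (L.get (Fin.castLE hm k))).1 :=
    fun k k' h => (hlt k k' h).1
  have hcol : StrictMono fun k : Fin m => pos S (w (L.get (Fin.castLE hm k))).2 :=
    fun k k' h => (hlt k k' h).2
  exact prod_X_mem_sup_span I (pos S) w (fun k => L.get (Fin.castLE hm k)) hrow hcol
    (hI ⟨_, _, hrow.injective, fun x y h => hcol.injective (congrArg (pos S) h),
      fun k => hU _ (L.get_mem _), rfl⟩)

lemma prod_X_mem_of_not_isNormal {n : ℕ} (w : Fin n → Fin d × Col 2 k₂)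
    (hw : ¬ IsNormal t S w) :
    ∏ l, (X (w l) : MvP d 2 k₂) ∈ (ISIdeal d k₂ t S).restrictScalars ℂ ⊔
      Submodule.span ℂ ((fun w : (n : ℕ) × (Fin n → Fin d × Col 2 k₂) =>
        ∏ l, (X (w.2 l) : MvP d 2 k₂)) '' {w' | weight (pos S) w'.2 < weight (pos S) w}) := by
  obtain ⟨i1, -, i3, i4, i5⟩ := ISIdeal_le_iff.1 (le_refl (ISIdeal d k₂ t S))
  by_contra hcon
  have hnm : ∀ l, (w l).2 ∉ S := fun l hl => hcon <| Submodule.mem_sup_left <|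
    Ideal.mem_of_dvd _ (Finset.dvd_prod_of_mem _ (Finset.mem_univ l))
      (X_mem_of_minorSet_one_subset i1 (w l).1 hl)
  refine hw ⟨hnm, fun L hL h => ?_, fun L hL h => ?_, fun hS L hL h => ?_⟩ <;>
    refine not_le.1 fun hm => hcon ?_
  · exact prod_X_mem_sup_span_of_chain _ w L hL _
      (fun l hl => mem_of_one_le_typ (hnm l) (h l hl)) i4 hm
  · exact prod_X_mem_sup_span_of_chain _ w L hL _
      (fun l hl => mem_of_typ_le_one (hnm l) (h l hl)) i5 hm
  · exact prod_X_mem_sup_span_of_chain _ w L hL _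
      (fun l hl => typ_eq_one_iff.1 (h l hl)) (i3 hS) hm

/-- Words with the same parametrized monomial, the first of which is antisorted, are congruent
modulo `I_S` unless the second one has larger weight. -/
lemma prod_X_sub_prod_X_mem {n n' : ℕ} {w : Fin n → Fin d × Col 2 k₂}
    {w' : Fin n' → Fin d × Col 2 k₂} {c : Fin n → ℕ} {c' : Fin n' → ℕ}
    (hw : ∀ l, (w l).2 ∉ S)
    (hμ : ∑ l, parMon (w l) (c l) = ∑ l, parMon (w' l) (c' l))
    (hanti : ∀ x y, WDom S w x y → c x ≠ c y)
    (hω : weight (pos S) w' ≤ weight (pos S) w) :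
    ∏ l, (X (w l) : MvP d 2 k₂) - ∏ l, X (w' l) ∈ ISIdeal d k₂ t S := by
  have e1 : Finset.univ.val.map (fun l => ((w l).1, c l)) =
      Finset.univ.val.map fun l => ((w' l).1, c' l) := map_eq_map_of_card_eq _ _ fun z => by
    rw [← sum_parMon_inl, ← sum_parMon_inl, hμ]
  have e2 : Finset.univ.val.map (fun l => (c l, (w l).2.2)) =
      Finset.univ.val.map fun l => (c' l, (w' l).2.2) := map_eq_map_of_card_eq _ _ fun z => by
    rw [← sum_parMon_inr_inl, ← sum_parMon_inr_inl, hμ]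
  have e1' := congrArg (Multiset.map fun z : Fin d × ℕ => ((z.1 : ℕ), z.2)) e1
  have e2' := congrArg (Multiset.map fun z : ℕ × Fin k₂ => (z.1, pos S (0, z.2))) e2
  simp only [Multiset.map_map, Function.comp_def] at e1' e2'
  obtain ⟨σ, hσ⟩ := exists_equiv_of_weight_le (row := fun l => ((w l).1 : ℕ))
    (col := fun l => pos S (w l).2) (c := c) (row' := fun l => ((w' l).1 : ℕ))
    (col' := fun l => pos S (w' l).2) (c' := c')
    e1' e2' hanti hω
  obtain ⟨τ, hτ⟩ := exists_equiv_of_card_fiber_eq (fun l => (w l).2) (fun l => (w' l).2)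
    fun z => by rw [← sum_parMon_inr_inr w c, ← sum_parMon_inr_inr w' c', hμ]
  let π : Equiv.Perm (Fin n) := σ.trans τ.symm
  have hπ : ∀ l, (w (π l)).2 = (w' (σ l)).2 := fun l => by
    rw [← hτ (π l)]; simp [π]
  have hsnd : ∀ l, (w' (σ l)).2.2 = (w l).2.2 := fun l => snd_eq_of_pos_eq (hσ l).2
  have hw' : ∀ l, w' (σ l) = ((w l).1, ((w (π l)).2.1, (w l).2.2)) := fun l =>
    Prod.ext (Fin.ext (hσ l).1) (Prod.ext (by simp [hπ]) (hsnd l))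
  rw [← σ.prod_comp fun l => (X (w' l) : MvP d 2 k₂)]
  simp only [hw']
  refine prod_sub_prod_comp_perm_mem (ISIdeal d k₂ t S)
    (fun i ρ a => (X (i, (ρ, a)) : MvP d 2 k₂)) (fun l => (w l).1) (fun l => (w l).2.2)
    (fun l => (w l).2.1) (fun l l' hll i i' => ?_) π fun l => by rw [hπ, hsnd]
  by_cases hρ : (w l).2.1 = (w l').2.1
  · rw [hρ, sub_self]; exact Ideal.zero_mem _
  · have hok : colOK k₂ S (w l).2.2 := by
      have h1 : ((w l).2.1, (w l).2.2) ∉ S := hw l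
      have h2 : ((w l').2.1, (w l).2.2) ∉ S := hll ▸ hw l'
      intro ρ
      rcases (by omega : ρ = (w l).2.1 ∨ ρ = (w l').2.1) with rfl | rfl
      · exact h1
      · exact h2
    exact binomial_mem_of_minorSet_two_subset ((ISIdeal_le_iff.1 le_rfl).2.1 _ hok) i i' rfl rfl

theorem ISIdeal_isRadical (ht : 2 ≤ t) : (ISIdeal d k₂ t S).IsRadical := by
  classical
  refine le_of_normal_forms (fun w : (n : ℕ) × (Fin n → Fin d × Col 2 k₂) =>
      ∏ l, (X (w.2 l) : MvP d 2 k₂)) (span_range_prod_X _)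
    ((ISIdeal d k₂ t S).restrictScalars ℂ) ((ISIdeal d k₂ t S).radical.restrictScalars ℂ)
    Ideal.le_radical (fun w => weight (pos S) w.2) (fun w => IsNormal t S w.2)
    (fun w hw => prod_X_mem_of_not_isNormal w.2 hw) ?_
  rintro ⟨n, w⟩ hw
  obtain ⟨q, C, c, hC, hC1, hqC, hanti, hwin⟩ := exists_coloring
    (fun l => ((w l).1 : ℕ)) (fun l => pos S (w l).2) (fun l => typ S (w l).2.2)
    (fun l => typ_le_two _) (fun _ _ h => pos_lt_pos h) (t - 1)
    (fun L hL h => Nat.le_sub_one_of_lt (hw.length_lt_of_one_le L hL h))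
    (fun L hL h => Nat.le_sub_one_of_lt (hw.length_lt_of_le_one L hL h))
  have hle := ISIdeal_le_ker_par (d := d) (S := S) ht (q := q) fun hS => by
    have := hw.length_lt_of_eq_one hS C hC hC1
    omega
  set Φ : MvP d 2 k₂ →ₐ[ℂ] MvPolynomial (ParVar d k₂) ℂ :=
    par S (fun a => colorLo q (typ S a)) fun a => colorHi q (t - 1) (typ S a)
  set μ := ∑ l, parMon (w l) (c l) with hμ
  refine ⟨(lcoeff ℂ μ).comp Φ.toLinearMap, fun f hf => ?_, ?_, fun w' hω => ?_⟩
  · have hf' : f ∈ RingHom.ker Φ :=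
      (RingHom.ker_isPrime Φ.toRingHom).isRadical (Ideal.radical_mono hle hf)
    rw [RingHom.mem_ker] at hf'
    simp [hf']
  · have hne : (((Fintype.piFinset fun l => Finset.Ico (colorLo q (typ S (w l).2.2))
        (colorHi q (t - 1) (typ S (w l).2.2))).filter
        fun c => ∑ l, parMon (w l) (c l) = μ).card : ℂ) ≠ 0 := by
      rw [Nat.cast_ne_zero, Finset.card_ne_zero]
      exact ⟨c, Finset.mem_filter.2 ⟨Fintype.mem_piFinset.2 fun l => Finset.mem_Ico.2 (hwin l),
        rfl⟩⟩
    rw [← coeff_par_prod_X S (fun a => colorLo q (typ S a))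
      (fun a => colorHi q (t - 1) (typ S a)) w hw.notMem] at hne
    exact hne
  · obtain ⟨n', w'⟩ := w'
    refine or_iff_not_imp_left.2 fun hne => ?_
    have hw' : ∀ l, (w' l).2 ∉ S := fun l hl => hne <| by
      simp only [LinearMap.comp_apply, AlgHom.toLinearMap_apply]
      rw [par_prod_X_eq_zero _ _ _ w' hl, map_zero]
    have hne' : coeff μ (Φ (∏ l, X (w' l))) ≠ 0 := hne
    rw [coeff_par_prod_X _ _ _ _ hw', Nat.cast_ne_zero, Finset.card_ne_zero] at hne'
    obtain ⟨c', hc'⟩ := hne'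
    exact prod_X_sub_prod_X_mem hw.notMem (Finset.mem_filter.1 hc').2.symm
      (fun x y h => (hanti x y h).ne) hω

end

lemma minorPoly_mem_of_X_mem {d k₁ k₂ r : ℕ} {I : Ideal (MvP d k₁ k₂)} {a : Fin r → Fin d}
    {b : Fin r → Col k₁ k₂} (k : Fin r) (hk : ∀ i, (X (i, b k) : MvP d k₁ k₂) ∈ I) :
    minorPoly d k₁ k₂ r a b ∈ I := by
  rw [← Ideal.Quotient.eq_zero_iff_mem, minorPoly, RingHom.map_det]
  exact Matrix.det_eq_zero_of_column_eq_zero k fun i => by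
    simpa using Ideal.Quotient.eq_zero_iff_mem.2 (hk (a i))

lemma ciIdeal_le_iff {d k₁ k₂ t : ℕ} {I : Ideal (MvP d k₁ k₂)} : ciIdeal d k₁ k₂ t ≤ I ↔
    (∀ j, minorSet d k₁ k₂ 2 (colSlice k₁ k₂ j) ⊆ I) ∧
      ∀ i, minorSet d k₁ k₂ t (rowSlice k₁ k₂ i) ⊆ I := by
  simp only [ciIdeal, minorIdeal, sup_le_iff, iSup_le_iff, Ideal.span_le]

lemma ciIdeal_le_ISIdeal {d k₂ t : ℕ} (S : Set (Col 2 k₂)) :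
    ciIdeal d 2 k₂ t ≤ ISIdeal d k₂ t S := by
  obtain ⟨i1, i2, -, i4, i5⟩ := ISIdeal_le_iff.1 (le_refl (ISIdeal d k₂ t S))
  refine ciIdeal_le_iff.2 ⟨fun j => ?_, fun ρ => ?_⟩
  · by_cases hj : colOK k₂ S j
    · exact i2 j hj
    obtain ⟨ρ, hρ⟩ : ∃ ρ, (ρ, j) ∈ S := by simpa only [colOK, not_forall, not_not] using hj
    rintro _ ⟨a, b, -, hb, hbj, rfl⟩
    have h : Function.Injective fun k => (b k).1 := fun k k' hk =>
      hb (Prod.ext hk ((hbj k).trans (hbj k').symm))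
    obtain ⟨k, hk⟩ := Finite.surjective_of_injective h ρ
    have hbk : b k = (ρ, j) := Prod.ext hk (hbj k)
    exact minorPoly_mem_of_X_mem k fun i => X_mem_of_minorSet_one_subset i1 i (hbk ▸ hρ)
  · rintro _ ⟨a, b, ha, hb, hbρ, rfl⟩
    by_cases hS : ∃ k, b k ∈ S
    · obtain ⟨k, hk⟩ := hS
      exact minorPoly_mem_of_X_mem k fun i => X_mem_of_minorSet_one_subset i1 i hk
    push Not at hS
    rcases (by omega : ρ = 0 ∨ ρ = 1) with rfl | rfl
    · exact i4 ⟨a, b, ha, hb, fun k => Or.inl ⟨hbρ k, hS k⟩, rfl⟩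
    · exact i5 ⟨a, b, ha, hb, fun k => Or.inl ⟨hbρ k, hS k⟩, rfl⟩

lemma exists_eq_smul_of_parallel {K D : Type*} [Field K] {u u' : D → K} (hu : u ≠ 0)
    (h : ∀ i i', u i * u' i' = u' i * u i') : ∃ r : K, u' = r • u := by
  obtain ⟨i, hi⟩ := Function.ne_iff.1 hu
  refine ⟨u' i / u i, funext fun i' => ?_⟩
  have := h i i'
  simp only [Pi.smul_apply, smul_eq_mul, Pi.zero_apply] at *
  field_simp
  linear_combination this

/-- If a maximal minor of the vectors `u` is nonzero and all minors bordering it vanish, then the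
border is a combination of the vectors `u`. -/
lemma exists_eq_sum_of_det_cons_eq_zero {K D : Type*} [Field K] {m : ℕ} (u₀ : D → K)
    (u : Fin m → D → K) (a : Fin m → D) (h : (Matrix.of fun i k => u k (a i)).det ≠ 0)
    (h0 : ∀ i₀, (Matrix.of fun i k => (Fin.cons u₀ u : Fin (m + 1) → D → K) k
      ((Fin.cons i₀ a : Fin (m + 1) → D) i)).det = 0) :
    ∃ γ : Fin m → K, ∀ i, u₀ i = ∑ k, u k i * γ k := by
  let δ : Fin m → K := fun k => (-1) ^ ((k : ℕ) + 1) *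
    (Matrix.of fun (i j : Fin m) => (Fin.cons u₀ u : Fin (m + 1) → D → K)
      (k.succ.succAbove j) (a i)).det
  refine ⟨fun k => -(δ k) / (Matrix.of fun i k => u k (a i)).det, fun i₀ => ?_⟩
  have := h0 i₀
  rw [Matrix.det_succ_row_zero, Fin.sum_univ_succ] at this
  have e1 : ∀ k : Fin (m + 1), (Matrix.of fun i k => (Fin.cons u₀ u : Fin (m + 1) → D → K) k
      ((Fin.cons i₀ a : Fin (m + 1) → D) i)).submatrix Fin.succ k.succAbove =
      Matrix.of fun i j => (Fin.cons u₀ u : Fin (m + 1) → D → K) (k.succAbove j) (a i) :=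
    fun k => by ext i j; simp
  simp only [e1, Matrix.of_apply, Fin.cons_zero, Fin.cons_succ, Fin.succAbove_zero, Fin.val_zero,
    pow_zero, one_mul, Fin.val_succ] at this
  have e2 : ∑ k : Fin m, u k i₀ * (-(δ k) / (Matrix.of fun i k => u k (a i)).det) =
      -(∑ k : Fin m, u k i₀ * δ k) / (Matrix.of fun i k => u k (a i)).det := by
    rw [← Finset.sum_neg_distrib, Finset.sum_div]
    exact Finset.sum_congr rfl fun k _ => by ring
  rw [e2, eq_div_iff h, eq_neg_iff_add_eq_zero, ← this]
  congr 1
  exact Finset.sum_congr rfl fun k _ => by simp only [δ]; ring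

section

variable {d k₂ : ℕ} (x : Fin d × Col 2 k₂ → ℂ)

lemma aeval_minorPoly {k₁ r : ℕ} (x : Fin d × Col k₁ k₂ → ℂ) (a : Fin r → Fin d)
    (b : Fin r → Col k₁ k₂) :
    aeval x (minorPoly d k₁ k₂ r a b) = (Matrix.of fun i j => x (a i, b j)).det := by
  rw [minorPoly, AlgHom.map_det]
  congr 1
  ext i j
  simp

/-- Columns of a minor may be rescaled without affecting its vanishing. -/
lemma det_eq_zero_iff_of_smul {r : ℕ} (a : Fin r → Fin d) (b b' : Fin r → Col 2 k₂)
    (hb : ∀ k, ∃ s : ℂ, ∀ i, x (i, b k) = s * x (i, b' k))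
    (h : (Matrix.of fun i k => x (a i, b' k)).det = 0) :
    (Matrix.of fun i k => x (a i, b k)).det = 0 := by
  choose s hs using hb
  have : (Matrix.of fun i k => x (a i, b k)) =
      Matrix.of fun i k => s k * (Matrix.of fun i k => x (a i, b' k)) i k := by
    ext i k; simp [hs]
  rw [this, Matrix.det_mul_row, h, mul_zero]

/-- Every point of the variety of the conditional independence ideal lies on the variety of some
`I_S`. -/
lemma exists_ISIdeal_le_ker_aeval {t : ℕ} (ht : 2 ≤ t)
    (hx : ciIdeal d 2 k₂ t ≤ RingHom.ker (aeval x : MvP d 2 k₂ →ₐ[ℂ] ℂ)) :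
    ∃ S, ISIdeal d k₂ t S ≤ RingHom.ker (aeval x : MvP d 2 k₂ →ₐ[ℂ] ℂ) := by
  obtain ⟨m, rfl⟩ : ∃ m, t = m + 1 := ⟨t - 1, by omega⟩
  obtain ⟨hcol, hrow⟩ := ciIdeal_le_iff.1 hx
  have hpar : ∀ p p' : Col 2 k₂, p.2 = p'.2 → ∀ i i',
      x (i, p) * x (i', p') = x (i, p') * x (i', p) := fun p p' h i i' => by
    have := binomial_mem_of_minorSet_two_subset (hcol p.2) i i' (p := p) (p' := p') rfl h.symm
    rw [RingHom.mem_ker] at this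
    simpa [sub_eq_zero] using this
  have hrow' : ∀ (a : Fin (m + 1) → Fin d) (b : Fin (m + 1) → Col 2 k₂) (ρ : Fin 2),
      (∀ k, (b k).1 = ρ) → (Matrix.of fun i k => x (a i, b k)).det = 0 := fun a b ρ hb => by
    by_cases ha : Function.Injective a
    · by_cases hbi : Function.Injective b
      · rw [← aeval_minorPoly]
        exact hrow ρ ⟨a, b, ha, hbi, hb, rfl⟩
      · obtain ⟨k, k', hk, hne⟩ := Function.not_injective_iff.1 hbi
        exact Matrix.det_zero_of_column_eq hne fun i => by simp [hk]
    · obtain ⟨k, k', hk, hne⟩ := Function.not_injective_iff.1 ha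
      exact Matrix.det_zero_of_row_eq hne (by ext; simp [hk])
  let S₀ : Set (Col 2 k₂) := {p | ∀ i, x (i, p) = 0}
  have hsmul : ∀ p p' : Col 2 k₂, p.2 = p'.2 → p' ∉ S₀ → ∃ s : ℂ, ∀ i, x (i, p) = s * x (i, p') :=
    fun p p' h hp' => by
      obtain ⟨s, hs⟩ := exists_eq_smul_of_parallel (u := fun i => x (i, p'))
        (u' := fun i => x (i, p)) (fun h0 => hp' fun i => congrFun h0 i)
        fun i i' => hpar p' p h.symm i i'
      exact ⟨s, fun i => congrFun hs i⟩
  by_cases hcase : tCond k₂ S₀ → minorSet d 2 k₂ m (CSet k₂ S₀) ⊆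
      RingHom.ker (aeval x : MvP d 2 k₂ →ₐ[ℂ] ℂ)
  · have hρ : ∀ ρ : Fin 2, minorSet d 2 k₂ (m + 1) ((rowSlice 2 k₂ ρ \ S₀) ∪ CSet k₂ S₀) ⊆
        RingHom.ker (aeval x : MvP d 2 k₂ →ₐ[ℂ] ℂ) := by
      rintro ρ _ ⟨a, b, -, -, hb, rfl⟩
      rw [SetLike.mem_coe, RingHom.mem_ker, aeval_minorPoly]
      refine det_eq_zero_iff_of_smul x a b (fun k => (ρ, (b k).2)) (fun k => ?_)
        (hrow' _ _ ρ fun _ => rfl)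
      rcases hb k with ⟨hk, -⟩ | hk
      · have : (ρ, (b k).2) = b k := Prod.ext (Eq.symm hk) rfl
        exact ⟨1, fun i => by rw [this, one_mul]⟩
      · exact hsmul _ _ rfl (hk ρ)
    refine ⟨S₀, ISIdeal_le_iff.2 ⟨?_, fun j _ => hcol j, hcase, hρ 0, hρ 1⟩⟩
    rintro _ ⟨a, b, -, -, hb, rfl⟩
    rw [SetLike.mem_coe, RingHom.mem_ker, aeval_minorPoly]
    exact Matrix.det_eq_zero_of_column_eq_zero 0 fun i => hb 0 (a i)
  · push Not at hcase
    obtain ⟨-, hnot⟩ := hcase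
    obtain ⟨_, ⟨a, b, -, -, hb, rfl⟩, hne⟩ := Set.not_subset.1 hnot
    rw [SetLike.mem_coe, RingHom.mem_ker, aeval_minorPoly] at hne
    have hspan : ∀ p : Col 2 k₂, ∃ γ : Fin m → ℂ, ∀ i, x (i, p) = ∑ k, x (i, b k) * γ k := by
      intro p
      obtain ⟨γ, hγ⟩ := exists_eq_sum_of_det_cons_eq_zero (fun i => x (i, p))
        (fun k i => x (i, (p.1, (b k).2))) a
        (mt (det_eq_zero_iff_of_smul x a b (fun k => (p.1, (b k).2))
          fun k => hsmul _ _ rfl (hb k p.1)) hne) fun i₀ => by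
          rw [← hrow' (Fin.cons i₀ a) (Fin.cons p fun k => (p.1, (b k).2)) p.1
            (Fin.cases rfl fun _ => rfl)]
          congr 1
          ext i k
          refine Fin.cases ?_ (fun k => ?_) k <;> simp
      choose s hs using fun k => hsmul (p.1, (b k).2) (b k) rfl (hb k (b k).1)
      refine ⟨fun k => s k * γ k, fun i => ?_⟩
      rw [hγ]
      exact Finset.sum_congr rfl fun k _ => by rw [hs]; ring
    choose γ hγ using hspan
    have hall : ∀ U, minorSet d 2 k₂ (m + 1) U ⊆
        RingHom.ker (aeval x : MvP d 2 k₂ →ₐ[ℂ] ℂ) := by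
      rintro U _ ⟨a', b', -, -, -, rfl⟩
      rw [SetLike.mem_coe, RingHom.mem_ker, aeval_minorPoly,
        ← det_eq_zero_of_card_lt (by simp) (Matrix.of fun i k => x (a' i, b k))
          (Matrix.of fun k j => γ (b' j) k)]
      congr 1
      ext i j
      simp [Matrix.mul_apply, hγ (b' j)]
    refine ⟨∅, ISIdeal_le_iff.2 ⟨?_, fun j _ => hcol j, fun h => ?_, hall _, hall _⟩⟩
    · rintro _ ⟨a, b, -, -, hb, rfl⟩
      exact absurd (hb 0) (Set.notMem_empty _)
    · obtain ⟨⟨ℓ, hℓ, -⟩, -⟩ := h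
      exact absurd hℓ (Set.notMem_empty _)

end

/-- for `k₁ = 2` and `2 ≤ t ≤ min(k₂, d)`,
`√𝓘_C = ⋂_{S ⊆ [2]×[k₂]} I_S` (no radicals on the components). -/
theorem radical_ciIdeal_eq_iInf_ISIdeal
    (d k₂ t : ℕ) (ht : 2 ≤ t) (htk : t ≤ k₂) (htd : t ≤ d) :
    (ciIdeal d 2 k₂ t).radical = ⨅ S : Set (Col 2 k₂), ISIdeal d k₂ t S := by
  refine le_antisymm (le_iInf fun S => ?_) fun f hf => ?_
  · exact (ISIdeal_isRadical ht).radical_le_iff.2 (ciIdeal_le_ISIdeal S)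
  · rw [← vanishingIdeal_zeroLocus_eq_radical (K := ℂ)]
    intro x hx
    obtain ⟨S, hS⟩ := exists_ISIdeal_le_ker_aeval x ht fun p hp => hx p hp
    exact hS (Ideal.mem_iInf.1 hf S)

end CI
end
end

section
/- Let k₁ = 2 and 2 ≤ t ≤ min(k₂, d). If S ⊆ [2]×[k₂] satisfies C_j ⊆ S for some j ∈ [k₂], then I_S is not minimal among {I_{S'} : S' ⊆ [2]×[k₂]}; that is, there exists S' ⊆ [2]×[k₂] with I_{S'} ⊊ I_S. -/
noncomputable section

open MvPolynomial

namespace CI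

lemma minorPoly_mem_of_column {d k₁ k₂ r : ℕ} {I : Ideal (MvP d k₁ k₂)}
    (a : Fin r → Fin d) (b : Fin r → Col k₁ k₂) (m : Fin r)
    (h : ∀ i : Fin d, (X (i, b m) : MvP d k₁ k₂) ∈ I) :
    minorPoly d k₁ k₂ r a b ∈ I := by
  rw [← Ideal.Quotient.eq_zero_iff_mem, minorPoly, RingHom.map_det]
  refine Matrix.det_eq_zero_of_column_eq_zero m fun i => ?_
  simpa using Ideal.Quotient.eq_zero_iff_mem.2 (h (a i))

lemma X_mem_minorSet_one {d k₁ k₂ : ℕ} {U : Set (Col k₁ k₂)} {p : Col k₁ k₂} (hp : p ∈ U)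
    (i : Fin d) : (X (i, p) : MvP d k₁ k₂) ∈ minorSet d k₁ k₂ 1 U :=
  ⟨fun _ => i, fun _ => p, Function.injective_of_subsingleton _,
    Function.injective_of_subsingleton _, fun _ => hp, by simp [minorPoly]⟩

lemma X_mem_ISIdeal {d k₂ t : ℕ} {S : Set (Col 2 k₂)} {p : Col 2 k₂} (hp : p ∈ S)
    (i : Fin d) : (X (i, p) : MvP d 2 k₂) ∈ ISIdeal d k₂ t S :=
  Ideal.subset_span (Or.inl (Or.inl (Or.inl (Or.inl (X_mem_minorSet_one hp i)))))

/-- Minors using a column of `S` lie in `I_S`, so that only the remaining ones matter. -/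
lemma minorSet_subset_ISIdeal {d k₂ t r : ℕ} {S U V : Set (Col 2 k₂)}
    (hUV : U ⊆ V ∪ S) (hV : minorSet d 2 k₂ r V ⊆ FSset d k₂ t S) :
    minorSet d 2 k₂ r U ⊆ ISIdeal d k₂ t S := by
  rintro _ ⟨a, b, ha, hb, hbU, rfl⟩
  by_cases h : ∃ m, b m ∈ S
  · obtain ⟨m, hm⟩ := h
    exact minorPoly_mem_of_column a b m (X_mem_ISIdeal hm)
  · push Not at h
    exact Ideal.subset_span
      (hV ⟨a, b, ha, hb, fun m => (hUV (hbU m)).resolve_right (h m), rfl⟩)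

lemma ISIdeal_le_of_subset {d k₂ t : ℕ} {S S' : Set (Col 2 k₂)} (hS : S' ⊆ S)
    (hC : CSet k₂ S' ⊆ CSet k₂ S ∪ S) (ht : tCond k₂ S' → tCond k₂ S) :
    ISIdeal d k₂ t S' ≤ ISIdeal d k₂ t S := by
  have hU (i : Fin 2) : (rowSlice 2 k₂ i \ S') ∪ CSet k₂ S' ⊆
      ((rowSlice 2 k₂ i \ S) ∪ CSet k₂ S) ∪ S := by
    rintro p (hp | hp)
    · by_cases hpS : p ∈ S
      · exact Or.inr hpS
      · exact Or.inl (Or.inl ⟨hp.1, hpS⟩)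
    · exact (hC hp).imp Or.inr id
  refine Ideal.span_le.2 ?_
  rintro f ((((hf | hf) | hf) | hf) | hf)
  · exact minorSet_subset_ISIdeal (V := S) (fun p hp => Or.inr (hS hp))
      (fun g hg => Or.inl (Or.inl (Or.inl (Or.inl hg)))) hf
  · simp only [Set.mem_iUnion] at hf
    obtain ⟨l, hl, hf⟩ := hf
    by_cases hlS : colOK k₂ S l
    · exact Ideal.subset_span
        (Or.inl (Or.inl (Or.inl (Or.inr (Set.mem_biUnion (by exact hlS) hf)))))
    · obtain ⟨a, b, -, -, hb, rfl⟩ := hf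
      have hb0 : (b 0).2 = l := hb 0
      refine minorPoly_mem_of_column a b 0 (X_mem_ISIdeal ((hC ?_).resolve_left ?_))
      · simpa [CSet, hb0] using hl
      · simpa [CSet, hb0] using hlS
  · simp only [Set.mem_iUnion] at hf
    obtain ⟨hc, hf⟩ := hf
    exact minorSet_subset_ISIdeal hC
      (fun g hg => Or.inl (Or.inl (Or.inr (Set.mem_iUnion.2 ⟨ht hc, hg⟩)))) hf
  · exact minorSet_subset_ISIdeal (hU 0) (fun g hg => Or.inl (Or.inr hg)) hf
  · exact minorSet_subset_ISIdeal (hU 1) (fun g hg => Or.inr hg) hf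

/-- Minors of size at least two vanish at a matrix with a single nonzero entry. -/
lemma eval_single_minor_of_two_le {d k₁ k₂ r : ℕ} (hr : 2 ≤ r) {U : Set (Col k₁ k₂)}
    (q : Fin d × Col k₁ k₂) {f : MvP d k₁ k₂} (hf : f ∈ minorSet d k₁ k₂ r U) :
    eval (Pi.single q 1) f = 0 := by
  obtain ⟨a, b, ha, -, -, rfl⟩ := hf
  have : Nontrivial (Fin r) := Fin.nontrivial_iff_two_le.2 hr
  obtain ⟨m, hm⟩ : ∃ m, a m ≠ q.1 := by
    by_contra! h
    obtain ⟨x, y, hxy⟩ := exists_pair_ne (Fin r)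
    exact hxy (ha ((h x).trans (h y).symm))
  rw [minorPoly, RingHom.map_det]
  refine Matrix.det_eq_zero_of_row_eq_zero m fun i => ?_
  have : (a m, b i) ≠ q := fun h => hm (congrArg Prod.fst h)
  simp [this]

lemma eval_single_minor_of_notMem {d k₁ k₂ r : ℕ} (hr : 1 ≤ r) {U : Set (Col k₁ k₂)}
    (q : Fin d × Col k₁ k₂) (hq : q.2 ∉ U) {f : MvP d k₁ k₂}
    (hf : f ∈ minorSet d k₁ k₂ r U) : eval (Pi.single q 1) f = 0 := by
  obtain ⟨a, b, -, -, hb, rfl⟩ := hf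
  rw [minorPoly, RingHom.map_det]
  refine Matrix.det_eq_zero_of_column_eq_zero ⟨0, hr⟩ fun i => ?_
  have : (a i, b ⟨0, hr⟩) ≠ q := fun h => hq (congrArg Prod.snd h ▸ hb _)
  simp [this]

lemma X_notMem_ISIdeal {d k₂ t : ℕ} (ht : 2 ≤ t) {S : Set (Col 2 k₂)} {p : Col 2 k₂}
    (hp : p ∉ S) (hC : tCond k₂ S → p ∉ CSet k₂ S) (i : Fin d) :
    (X (i, p) : MvP d 2 k₂) ∉ ISIdeal d k₂ t S := by
  have hle : ISIdeal d k₂ t S ≤ RingHom.ker (eval (Pi.single (i, p) (1 : ℂ))) := by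
    refine Ideal.span_le.2 ?_
    rintro f ((((hf | hf) | hf) | hf) | hf)
    · exact eval_single_minor_of_notMem le_rfl _ hp hf
    · simp only [Set.mem_iUnion] at hf
      obtain ⟨l, -, hf⟩ := hf
      exact eval_single_minor_of_two_le le_rfl _ hf
    · simp only [Set.mem_iUnion] at hf
      obtain ⟨hc, hf⟩ := hf
      exact eval_single_minor_of_notMem (by omega) _ (hC hc) hf
    · exact eval_single_minor_of_two_le ht _ hf
    · exact eval_single_minor_of_two_le ht _ hf
  intro h
  simpa using hle h

lemma ISIdeal_lt_of_subset {d k₂ t : ℕ} (ht : 2 ≤ t) (hd : 0 < d) {S S' : Set (Col 2 k₂)}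
    (hS : S' ⊆ S) (hC : CSet k₂ S' ⊆ CSet k₂ S ∪ S) (hc : tCond k₂ S' → tCond k₂ S)
    {p : Col 2 k₂} (hp : p ∈ S) (hp' : p ∉ S') (hpC : tCond k₂ S' → p ∉ CSet k₂ S') :
    ISIdeal d k₂ t S' < ISIdeal d k₂ t S :=
  lt_of_le_of_ne (ISIdeal_le_of_subset hS hC hc) fun h =>
    X_notMem_ISIdeal ht hp' hpC ⟨0, hd⟩ (h ▸ X_mem_ISIdeal hp ⟨0, hd⟩)

lemma CSet_diff_subset {k₂ : ℕ} {S T : Set (Col 2 k₂)} {j : Fin k₂}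
    (hj : colSlice 2 k₂ j ⊆ S) (hT : T ⊆ colSlice 2 k₂ j) :
    CSet k₂ (S \ T) ⊆ CSet k₂ S ∪ S := by
  intro p hp
  by_cases hpj : p.2 = j
  · exact Or.inr (hj hpj)
  · exact Or.inl fun i hi => hp i ⟨hi, fun h => hpj (show ((i, p.2) : Col 2 k₂) ∈ colSlice 2 k₂ j from hT h)⟩

/-- if `C_j ⊆ S` for some `j`, then `I_S` is not minimal among
`{I_{S'} : S' ⊆ [2]×[k₂]}`, i.e. there is `S'` with `I_{S'} ⊊ I_S`. -/
theorem not_minimal_of_colSlice_subset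
    (d k₂ t : ℕ) (ht : 2 ≤ t) (htk : t ≤ k₂) (htd : t ≤ d)
    (S : Set (Col 2 k₂)) (j : Fin k₂) (hj : colSlice 2 k₂ j ⊆ S) :
    ∃ S' : Set (Col 2 k₂), ISIdeal d k₂ t S' < ISIdeal d k₂ t S := by
  have hd : 0 < d := by omega
  have h1 : ((1 : Fin 2), j) ∈ colSlice 2 k₂ j := rfl
  by_cases hc : tCond k₂ S
  · refine ⟨S \ {(1, j)}, ISIdeal_lt_of_subset ht hd Set.sdiff_subset
      (CSet_diff_subset hj (Set.singleton_subset_iff.2 h1)) (fun _ => hc) (hj h1)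
      (fun h => h.2 rfl) fun _ h => h 0 ⟨hj rfl, by simp⟩⟩
  · have hc' : ¬ tCond k₂ (S \ colSlice 2 k₂ j) := by
      rintro ⟨⟨l, hl, hl'⟩, m, hm, hm'⟩
      exact hc ⟨⟨l, hl.1, fun h => hl' ⟨h, hl.2⟩⟩, m, hm.1, fun h => hm' ⟨h, hm.2⟩⟩
    exact ⟨S \ colSlice 2 k₂ j, ISIdeal_lt_of_subset ht hd Set.sdiff_subset
      (CSet_diff_subset hj subset_rfl) (fun h => (hc' h).elim) (hj h1)
      (fun h => h.2 h1) fun h => (hc' h).elim⟩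

end CI
end
end

section
/- Let k₁ = 2 and 2 ≤ t ≤ min(k₂, d). If S ⊆ [2]×[k₂] is a minimal subset, then I_S is minimal among the set of ideals {I_{S'} : S' ⊆ [2]×[k₂]}; that is, there is no S' ⊆ [2]×[k₂] with I_{S'} ⊊ I_S. -/
noncomputable section

open MvPolynomial

namespace CI

open scoped Classical in
/-- The matrix whose column `p` is the basis vector `e_{f p.2}` if `p ∉ S` and `p.2 ∈ K`,
and zero otherwise. -/
def testPoint (d k₂ : ℕ) (S : Set (Col 2 k₂)) (K : Finset (Fin k₂)) (f : Fin k₂ → Fin d) :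
    Fin d × Col 2 k₂ → ℂ :=
  fun q => if q.2 ∉ S ∧ q.2.2 ∈ K ∧ q.1 = f q.2.2 then 1 else 0

theorem eval_minorPoly {d k₁ k₂ r : ℕ} (M : Fin d × Col k₁ k₂ → ℂ) (a : Fin r → Fin d)
    (b : Fin r → Col k₁ k₂) :
    eval M (minorPoly d k₁ k₂ r a b) = (Matrix.of fun i j => M (a i, b j)).det := by
  rw [minorPoly, RingHom.map_det]
  congr 1
  ext i j
  simp

theorem exists_finset_of_eval_minor_ne_zero {d k₂ r : ℕ} {S U : Set (Col 2 k₂)}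
    {K : Finset (Fin k₂)} {f : Fin k₂ → Fin d} {g : MvP d 2 k₂} (hg : g ∈ minorSet d 2 k₂ r U)
    (hne : eval (testPoint d k₂ S K f) g ≠ 0) :
    ∃ L ⊆ K, L.card = r ∧ ∀ l ∈ L, ∃ i, (i, l) ∈ U ∧ (i, l) ∉ S := by
  classical
  obtain ⟨a, b, -, -, hbU, rfl⟩ := hg
  rw [eval_minorPoly] at hne
  have hcol : ∀ j, b j ∉ S ∧ (b j).2 ∈ K := by
    intro j
    by_contra hj
    refine hne (Matrix.det_eq_zero_of_column_eq_zero j fun i => ?_)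
    simp only [Matrix.of_apply, testPoint]
    exact if_neg fun h => hj ⟨h.1, h.2.1⟩
  have hinj : Function.Injective fun j => (b j).2 := by
    intro j j' hjj
    by_contra hne'
    refine hne (Matrix.det_zero_of_column_eq hne' fun i => ?_)
    have hjj : (b j).2 = (b j').2 := hjj
    simp [testPoint, (hcol j).1, (hcol j').1, hjj]
  refine ⟨Finset.univ.image fun j => (b j).2, ?_, ?_, ?_⟩
  · intro l hl
    obtain ⟨j, -, rfl⟩ := Finset.mem_image.1 hl
    exact (hcol j).2
  · rw [Finset.card_image_of_injective _ hinj, Finset.card_univ, Fintype.card_fin]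
  · intro l hl
    obtain ⟨j, -, rfl⟩ := Finset.mem_image.1 hl
    exact ⟨(b j).1, hbU j, (hcol j).1⟩

theorem exists_minor_eval_ne_zero {d k₂ : ℕ} {S U : Set (Col 2 k₂)} {K : Finset (Fin k₂)}
    {f : Fin k₂ → Fin d} (hf : Set.InjOn f K) (ρ : Fin k₂ → Fin 2)
    (hρ : ∀ l ∈ K, (ρ l, l) ∈ U ∧ (ρ l, l) ∉ S) :
    ∃ g ∈ minorSet d 2 k₂ K.card U, eval (testPoint d k₂ S K f) g ≠ 0 := by
  let β := K.equivFin.symm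
  have hfβ : Function.Injective fun i => f (β i) := fun i j hij =>
    β.injective (Subtype.ext (hf (β i).2 (β j).2 hij))
  refine ⟨_, ⟨fun i => f (β i), fun i => (ρ (β i), β i), hfβ, ?_, ?_, rfl⟩, ?_⟩
  · intro i j hij
    exact β.injective (Subtype.ext (Prod.ext_iff.1 hij).2)
  · exact fun i => (hρ _ (β i).2).1
  · rw [eval_minorPoly]
    have hone : (Matrix.of fun i j => testPoint d k₂ S K f
        (f (β i), (ρ (β j), (β j : Fin k₂)))) = (1 : Matrix _ _ ℂ) := by
      ext i j
      rw [Matrix.one_apply]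
      have h := hρ _ (β j).2
      have heq : f (β i) = f (β j) ↔ i = j := hfβ.eq_iff
      simp [testPoint, h.2, heq]
    rw [hone, Matrix.det_one]
    exact one_ne_zero

open scoped Classical in
theorem eval_testPoint_eq_zero {d k₂ t : ℕ} {S : Set (Col 2 k₂)} {K : Finset (Fin k₂)}
    {f : Fin k₂ → Fin d} (hK : K.card ≤ t)
    (hrow : K.card = t → ∀ i, ∃ l ∈ K, (i, l) ∈ S)
    (hC : tCond k₂ S → (K.filter (colOK k₂ S)).card < t - 1)
    {g : MvP d 2 k₂} (hg : g ∈ ISIdeal d k₂ t S) : eval (testPoint d k₂ S K f) g = 0 := by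
  have hrows : ∀ i, ∀ g ∈ minorSet d 2 k₂ t ((rowSlice 2 k₂ i \ S) ∪ CSet k₂ S),
      eval (testPoint d k₂ S K f) g = 0 := by
    intro i g hg
    by_contra hne
    obtain ⟨L, hLK, hL, h⟩ := exists_finset_of_eval_minor_ne_zero hg hne
    obtain rfl : L = K := Finset.eq_of_subset_of_card_le hLK (hL ▸ hK)
    obtain ⟨l, hl, hlS⟩ := hrow hL i
    obtain ⟨i', hi' | hi', hi'S⟩ := h l hl
    · obtain rfl : i' = i := hi'.1
      exact hi'S hlS
    · exact hi' i hlS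
  suffices h : ISIdeal d k₂ t S ≤ RingHom.ker (eval (testPoint d k₂ S K f)) from h hg
  refine Ideal.span_le.2 fun g hg => ?_
  change eval (testPoint d k₂ S K f) g = 0
  rcases hg with (((hg | hg) | hg) | hg) | hg
  · by_contra hne
    obtain ⟨L, -, hL, h⟩ := exists_finset_of_eval_minor_ne_zero hg hne
    obtain ⟨l, hl⟩ := Finset.card_pos.1 (hL ▸ one_pos)
    obtain ⟨i, hi, hi'⟩ := h l hl
    exact hi' hi
  · simp only [Set.mem_iUnion] at hg
    obtain ⟨j, -, hg⟩ := hg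
    by_contra hne
    obtain ⟨L, -, hL, h⟩ := exists_finset_of_eval_minor_ne_zero hg hne
    have hLj : L ⊆ {j} := fun l hl => by
      obtain ⟨i, hi, -⟩ := h l hl
      exact Finset.mem_singleton.2 hi
    have := Finset.card_le_card hLj
    rw [hL, Finset.card_singleton] at this
    omega
  · simp only [Set.mem_iUnion] at hg
    obtain ⟨ht, hg⟩ := hg
    by_contra hne
    obtain ⟨L, hLK, hL, h⟩ := exists_finset_of_eval_minor_ne_zero hg hne
    have hLC : L ⊆ K.filter (colOK k₂ S) := fun l hl => by
      obtain ⟨i, hi, -⟩ := h l hl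
      exact Finset.mem_filter.2 ⟨hLK hl, hi⟩
    have := Finset.card_le_card hLC
    have := hC ht
    omega
  · exact hrows 0 g hg
  · exact hrows 1 g hg

open scoped Classical in
theorem ncard_rowSlice_inter (k₂ : ℕ) (S : Set (Col 2 k₂)) (i : Fin 2) :
    (rowSlice 2 k₂ i ∩ S).ncard = (Finset.univ.filter fun l => (i, l) ∈ S).card := by
  have h : rowSlice 2 k₂ i ∩ S =
      (fun l => (i, l)) '' (Finset.univ.filter fun l => (i, l) ∈ S : Finset (Fin k₂)) := by
    ext ⟨i', l⟩
    simp only [rowSlice, Set.mem_inter_iff, Set.mem_ofPred_eq, Set.mem_image, Finset.coe_filter,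
      Finset.mem_univ, true_and, Prod.mk.injEq]
    constructor
    · rintro ⟨rfl, hl⟩
      exact ⟨l, hl, rfl, rfl⟩
    · rintro ⟨l', hl', rfl, rfl⟩
      exact ⟨rfl, hl'⟩
  rw [h, Set.ncard_image_of_injective _ (Prod.mk_right_injective i), Set.ncard_coe_finset]

theorem noColumn.notMem_of_mem {k₂ : ℕ} {S : Set (Col 2 k₂)} (hS : noColumn k₂ S) {i i' : Fin 2}
    (hi : i ≠ i') {l : Fin k₂} (hl : (i, l) ∈ S) : (i', l) ∉ S := by
  intro hl'
  refine hS l ?_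
  rintro ⟨a, b⟩ (rfl : b = l)
  obtain rfl | rfl : a = i ∨ a = i' := by omega
  · exact hl
  · exact hl'

theorem minimalSubset.not_colOK {k₂ : ℕ} {S : Set (Col 2 k₂)} (hS : minimalSubset k₂ 2 S)
    (hne : S.Nonempty) (l : Fin k₂) : ¬ colOK k₂ S l := by
  classical
  obtain ⟨hcol, -, -, -, hsum⟩ := hS.resolve_left hne.ne_empty
  intro hl
  have h := hsum rfl
  rw [uOf, vOf, min_add_max, ncard_rowSlice_inter, ncard_rowSlice_inter,
    ← Finset.card_union_of_disjoint] at h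
  · have huniv := (Finset.card_eq_iff_eq_univ _).1 (h.trans (Fintype.card_fin k₂).symm)
    have hmem := huniv ▸ Finset.mem_univ l
    simp only [Finset.mem_union, Finset.mem_filter, Finset.mem_univ, true_and] at hmem
    exact hmem.elim (hl 0) (hl 1)
  · refine Finset.disjoint_filter.2 fun l _ h0 => hcol.notMem_of_mem (by decide) h0

/-- The ideals `I_{S'}` contained in `I_S` satisfy `S' ⊆ S`. -/
theorem subset_of_ISIdeal_le {d k₂ t : ℕ} (ht : 2 ≤ t) (htd : t ≤ d) {S S' : Set (Col 2 k₂)}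
    (hS : minimalSubset k₂ t S) (hle : ISIdeal d k₂ t S' ≤ ISIdeal d k₂ t S) : S' ⊆ S := by
  classical
  rintro ⟨i, l⟩ hp
  by_contra hpS
  obtain ⟨g, hg, hne⟩ := exists_minor_eval_ne_zero (S := S) (U := S') (K := {l})
    (f := fun _ => (⟨0, by omega⟩ : Fin d)) (by simp) (fun _ => i) (by simpa using ⟨hp, hpS⟩)
  refine hne (eval_testPoint_eq_zero (t := t) (by simp; omega) (by simp; omega) ?_
    (hle (Ideal.subset_span (.inl (.inl (.inl (.inl hg)))))))
  intro hC
  obtain ⟨⟨m, hm, -⟩, -⟩ := hC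
  rcases ht.eq_or_lt with rfl | ht
  · simp [Finset.filter_singleton, hS.not_colOK ⟨_, hm⟩ l]
  · have := Finset.card_filter_le {l} (colOK k₂ S)
    rw [Finset.card_singleton] at this
    omega

theorem exists_injOn_fin {α : Type*} {d : ℕ} (K : Finset α) (hd : 0 < d) (hK : K.card ≤ d) :
    ∃ f : α → Fin d, Set.InjOn f K := by
  classical
  refine ⟨fun x => if h : x ∈ K then Fin.castLE hK (K.equivFin ⟨x, h⟩) else ⟨0, hd⟩, ?_⟩
  intro x hx y hy hxy
  have hx : x ∈ K := hx
  have hy : y ∈ K := hy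
  simpa [hx, hy] using hxy

theorem minimalSubset.eq_of_ISIdeal_le {d k₂ t : ℕ} (ht : 2 ≤ t) (htk : t ≤ k₂) (htd : t ≤ d)
    {S S' : Set (Col 2 k₂)} (hS : minimalSubset k₂ t S)
    (hle : ISIdeal d k₂ t S' ≤ ISIdeal d k₂ t S) : S' = S := by
  classical
  have hsub := subset_of_ISIdeal_le ht htd hS hle
  refine hsub.antisymm ?_
  rintro ⟨i, j⟩ hj
  by_contra hj'
  obtain ⟨hcol, hu, -, hv, -⟩ := hS.resolve_left (Set.nonempty_of_mem hj).ne_empty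
  have hpos : ∀ i, 1 ≤ (Finset.univ.filter fun l => (i, l) ∈ S).card := by
    have := le_min_iff.1 hu
    simp only [ncard_rowSlice_inter] at this
    exact Fin.forall_fin_two.2 this
  have hcard : ∀ i, (Finset.univ.filter fun l => (i, l) ∈ S).card ≤ k₂ - t + 1 := by
    have := max_le_iff.1 hv
    simp only [ncard_rowSlice_inter] at this
    exact Fin.forall_fin_two.2 this
  obtain ⟨i', hi'⟩ : ∃ i', i ≠ i' := ⟨i + 1, by omega⟩
  obtain ⟨m, hm⟩ := Finset.card_pos.1 (hpos i')
  have hm : (i', m) ∈ S := (Finset.mem_filter.1 hm).2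
  have hcompl : t - 1 ≤ (Finset.univ.filter fun l => (i, l) ∉ S).card := by
    have h := Finset.card_filter_add_card_filter_not (s := (Finset.univ : Finset (Fin k₂)))
      (fun l => (i, l) ∈ S)
    rw [Finset.card_univ, Fintype.card_fin] at h
    have := hcard i
    omega
  obtain ⟨K₀, hmK₀, hK₀, hK₀card⟩ := Finset.exists_subsuperset_card_eq
    (s := {m}) (t := Finset.univ.filter fun l => (i, l) ∉ S) (n := t - 1)
    (by simpa using hcol.notMem_of_mem hi'.symm hm) (by rw [Finset.card_singleton]; omega) hcompl
  rw [Finset.singleton_subset_iff] at hmK₀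
  have hK₀S : ∀ l ∈ K₀, (i, l) ∉ S := fun l hl => (Finset.mem_filter.1 (hK₀ hl)).2
  have hjK₀ : j ∉ K₀ := fun h => hK₀S j h hj
  have hKcard : (insert j K₀).card = t := by
    rw [Finset.card_insert_of_notMem hjK₀]
    omega
  obtain ⟨f, hf⟩ := exists_injOn_fin (d := d) (insert j K₀) (by omega) (by omega)
  obtain ⟨g, hg, hne⟩ := exists_minor_eval_ne_zero (S := S)
    (U := (rowSlice 2 k₂ i \ S') ∪ CSet k₂ S') hf (fun l => if l = j then i' else i) (by
      intro l hl
      rcases Finset.mem_insert.1 hl with rfl | hl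
      · have hi'l := hcol.notMem_of_mem hi' hj
        rw [if_pos rfl]
        refine ⟨.inr fun a ha => ?_, hi'l⟩
        obtain rfl | rfl : a = i ∨ a = i' := by omega
        · exact hj' ha
        · exact hi'l (hsub ha)
      · rw [if_neg (ne_of_mem_of_not_mem hl hjK₀)]
        exact ⟨.inl ⟨rfl, fun h => hK₀S l hl (hsub h)⟩, hK₀S l hl⟩)
  rw [hKcard] at hg
  have hgF : g ∈ FSset d k₂ t S' := by
    obtain rfl | rfl : i = 0 ∨ i = 1 := by omega
    · exact .inl (.inr hg)
    · exact .inr hg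
  refine hne (eval_testPoint_eq_zero hKcard.le ?_ ?_ (hle (Ideal.subset_span hgF)))
  · intro _ a
    obtain rfl | rfl : a = i ∨ a = i' := by omega
    · exact ⟨j, Finset.mem_insert_self _ _, hj⟩
    · exact ⟨m, Finset.mem_insert_of_mem hmK₀, hm⟩
  · intro _
    have hsubset : (insert j K₀).filter (colOK k₂ S) ⊆ K₀.erase m := by
      intro l hl
      obtain ⟨hlK, hlC⟩ := Finset.mem_filter.1 hl
      refine Finset.mem_erase.2 ⟨?_, (Finset.mem_insert.1 hlK).resolve_left ?_⟩
      · rintro rfl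
        exact hlC i' hm
      · rintro rfl
        exact hlC i hj
    have := Finset.card_le_card hsubset
    rw [Finset.card_erase_of_mem hmK₀] at this
    omega

/-- if `S ⊆ [2]×[k₂]` is a minimal subset, then `I_S` is minimal
among `{I_{S'} : S' ⊆ [2]×[k₂]}`: there is no `S'` with `I_{S'} ⊊ I_S`. -/
theorem ISIdeal_minimal_of_minimalSubset
    (d k₂ t : ℕ) (ht : 2 ≤ t) (htk : t ≤ k₂) (htd : t ≤ d)
    (S : Set (Col 2 k₂)) (hS : minimalSubset k₂ t S) :
    ¬ ∃ S' : Set (Col 2 k₂), ISIdeal d k₂ t S' < ISIdeal d k₂ t S := by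
  rintro ⟨S', hlt⟩
  exact hlt.ne (congrArg _ (hS.eq_of_ISIdeal_le ht htk htd hlt.le))

end CI
end
end
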